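/- Asymptotically almost surely, a random orientation G of the Turán graph T(n,k) (k ≥ 2 fixed) satisfies: every minimal feedback arc set of G contains ⌊n/k⌋ − k + 1 pairwise vertex-disjoint transitive k-cliques, and some minimal feedback arc set contains no more than that many; i.e. f_k(G) = ⌊n/k⌋ − k + 1. -/

import Mathlib

/-- A directed graph (relation) is acyclic if it has no directed cycle,
equivalently its transitive closure is irreflexive. -/
def IsAcyclicRel {V : Type*} (r : V → V → Prop) : Prop :=
  ∀ v, ¬ Relation.TransGen r v v

/-- `F` is a feedback arc set of the directed graph with edge set `E`:
`F ⊆ E` and every directed cycle of `E` contains an edge of `F`,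
equivalently the complement of `F` in `E` is acyclic. -/
def IsFAS {V : Type*} (E F : V → V → Prop) : Prop :=
  (∀ u v, F u v → E u v) ∧ IsAcyclicRel (fun u v => E u v ∧ ¬ F u v)

/-- A feedback arc set is minimal if no proper subset of it is a feedback arc set. -/
def IsMinFAS {V : Type*} (E F : V → V → Prop) : Prop :=
  IsFAS E F ∧ ∀ F' : V → V → Prop, (∀ u v, F' u v → F u v) → F' ≠ F → ¬ IsFAS E F'


/-- `S` induces a transitive `k`-clique in the directed graph `F`: it has `k` vertices,
any two distinct vertices of `S` are joined by an edge of `F`, and `F` restricted to `S`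
is acyclic. -/
def IsTransClique {V : Type*} (F : V → V → Prop) (k : ℕ) (S : Finset V) : Prop :=
  S.card = k ∧ (∀ u ∈ S, ∀ v ∈ S, u ≠ v → F u v ∨ F v u) ∧
    IsAcyclicRel (fun a b => a ∈ S ∧ b ∈ S ∧ F a b)

/-- The orientation of the Turán graph `T(n,k)` (vertices `Fin n`, parts the residue
classes mod `k`) determined by the orientation data `ω`. -/
def turanEdge {n : ℕ} (k : ℕ) (ω : Fin n → Fin n → Bool) (i j : Fin n) : Prop :=
  (i : ℕ) % k ≠ (j : ℕ) % k ∧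
    (if (i : ℕ) < (j : ℕ) then ω i j = true else ω j i = false)

section Tuples

/-- Two different tuples of `Q` differ in every coordinate. -/
def TuplesDisjoint {k M : ℕ} (Q : Finset (Fin k → Fin M)) : Prop :=
  ∀ q ∈ Q, ∀ q' ∈ Q, q ≠ q' → ∀ j, q j ≠ q' j

/-- The vertices `(i, q i)` with `i ∈ J` are pairwise adjacent. -/
def CliqueOn {k M : ℕ} (R : Fin k → Fin M → Fin k → Fin M → Prop) (J : Finset (Fin k))
    (q : Fin k → Fin M) : Prop :=
  ∀ i ∈ J, ∀ j ∈ J, i ≠ j → R i (q i) j (q j)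

/-- The vertex `(i, w)` is adjacent to all `(j, q j)` with `j ≠ i`. -/
def Joins {k M : ℕ} (R : Fin k → Fin M → Fin k → Fin M → Prop) (i : Fin k) (w : Fin M)
    (q : Fin k → Fin M) : Prop :=
  ∀ j, j ≠ i → R i w j (q j)

open Classical in
/-- Any `s` disjoint tuples and `s` vertices of one part have joining density at least `1 / D`. -/
def JoinDense {k M : ℕ} (R : Fin k → Fin M → Fin k → Fin M → Prop) (s D : ℕ) : Prop :=
  ∀ (i : Fin k) (Q : Finset (Fin k → Fin M)) (W : Finset (Fin M)), TuplesDisjoint Q →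
    s ≤ Q.card → s ≤ W.card →
      Q.card * W.card ≤ D * ((Q ×ˢ W).filter (fun p => Joins R i p.2 p.1)).card

variable {k M : ℕ} {R : Fin k → Fin M → Fin k → Fin M → Prop}

theorem TuplesDisjoint.mono {Q Q' : Finset (Fin k → Fin M)} (h : TuplesDisjoint Q)
    (hs : Q' ⊆ Q) : TuplesDisjoint Q' :=
  fun q hq q' hq' => h q (hs hq) q' (hs hq')

theorem TuplesDisjoint.injOn {Q : Finset (Fin k → Fin M)} (h : TuplesDisjoint Q) (j : Fin k) :
    Set.InjOn (fun q : Fin k → Fin M => q j) Q := by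
  intro q hq q' hq' e
  by_contra hne
  exact h q hq q' hq' hne j e

open Classical in
theorem TuplesDisjoint.card_image {Q : Finset (Fin k → Fin M)} (h : TuplesDisjoint Q)
    (j : Fin k) : (Q.image (fun q => q j)).card = Q.card :=
  Finset.card_image_of_injOn (h.injOn j)

open Classical in
theorem TuplesDisjoint.insert {Q : Finset (Fin k → Fin M)} (h : TuplesDisjoint Q)
    {q : Fin k → Fin M} (hq : ∀ j, q j ∉ Q.image (fun q' => q' j)) :
    TuplesDisjoint (insert q Q) := by
  have key : ∀ q' ∈ Q, ∀ j, q j ≠ q' j := fun q' hq' j e =>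
    hq j (Finset.mem_image.2 ⟨q', hq', e.symm⟩)
  intro a ha b hb hab j
  rcases Finset.mem_insert.1 ha with ha | ha <;> rcases Finset.mem_insert.1 hb with hb | hb
  · exact absurd (ha.trans hb.symm) hab
  · exact ha ▸ key b hb j
  · exact hb ▸ (key a ha j).symm
  · exact h a ha b hb hab j

open Classical in
theorem TuplesDisjoint.union {Q Q' : Finset (Fin k → Fin M)} (h : TuplesDisjoint Q)
    (h' : TuplesDisjoint Q') (hd : ∀ q ∈ Q, ∀ q' ∈ Q', ∀ j, q j ≠ q' j) :
    TuplesDisjoint (Q ∪ Q') := by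
  intro a ha b hb hab j
  rcases Finset.mem_union.1 ha with ha | ha <;> rcases Finset.mem_union.1 hb with hb | hb
  · exact h a ha b hb hab j
  · exact hd a ha b hb j
  · exact (hd b hb a ha j).symm
  · exact h' a ha b hb hab j

open Classical in
theorem exists_disjoint_tuples (P : (Fin k → Fin M) → Prop) (L : ℕ) (hk : 0 < k)
    (hP : ∀ A : Fin k → Finset (Fin M), (∀ i, L ≤ (A i).card) → ∃ q, P q ∧ ∀ i, q i ∈ A i)
    (t : ℕ) : ∀ A : Fin k → Finset (Fin M), (∀ i, L + t ≤ (A i).card) →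
      ∃ Q, TuplesDisjoint Q ∧ Q.card = t ∧ ∀ q ∈ Q, P q ∧ ∀ i, q i ∈ A i := by
  induction t with
  | zero => exact fun A _ => ⟨∅, by simp [TuplesDisjoint], rfl, by simp⟩
  | succ t ih =>
    intro A hA
    obtain ⟨q, hq, hqA⟩ := hP A fun i => by have := hA i; omega
    obtain ⟨Q, hQ, hc, hQP⟩ := ih (fun i => (A i).erase (q i)) fun i => by
      rw [Finset.card_erase_of_mem (hqA i)]; have := hA i; omega
    have hnew : ∀ j, q j ∉ Q.image (fun q' => q' j) := by
      intro j hj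
      obtain ⟨q', hq', e⟩ := Finset.mem_image.1 hj
      have := (hQP q' hq').2 j
      simp only [Finset.mem_erase] at this
      exact this.1 e
    refine ⟨insert q Q, hQ.insert hnew, ?_, ?_⟩
    · rw [Finset.card_insert_of_notMem, hc]
      exact fun h => hnew ⟨0, hk⟩ (Finset.mem_image_of_mem _ h)
    · intro q' hq'
      rcases Finset.mem_insert.1 hq' with rfl | hq'
      · exact ⟨hq, hqA⟩
      · exact ⟨(hQP q' hq').1, fun i => Finset.mem_of_mem_erase ((hQP q' hq').2 i)⟩

open Classical in
theorem JoinDense.exists_joins {s D : ℕ} (hB : JoinDense R s D) (hs : 0 < s) (i : Fin k)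
    {Q : Finset (Fin k → Fin M)} {W : Finset (Fin M)} (hQ : TuplesDisjoint Q)
    (hQs : s ≤ Q.card) (hWs : s ≤ W.card) : ∃ q ∈ Q, ∃ w ∈ W, Joins R i w q := by
  have h := hB i Q W hQ hQs hWs
  have h0 : 0 < Q.card * W.card := Nat.mul_pos (by omega) (by omega)
  have h1 : 0 < ((Q ×ˢ W).filter (fun p => Joins R i p.2 p.1)).card := by
    by_contra hc
    have : ((Q ×ˢ W).filter (fun p => Joins R i p.2 p.1)).card = 0 := by omega
    rw [this] at h; omega
  obtain ⟨p, hp⟩ := Finset.card_pos.1 h1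
  rw [Finset.mem_filter, Finset.mem_product] at hp
  exact ⟨p.1, hp.1.1, p.2, hp.1.2, hp.2⟩

theorem CliqueOn.update (hR : ∀ i a j b, R i a j b → R j b i a) {J : Finset (Fin k)}
    {q : Fin k → Fin M} {i : Fin k} {w : Fin M} (hw : Joins R i w q)
    (hq : ∀ a ∈ J, ∀ b ∈ J, a ≠ b → a ≠ i → b ≠ i → R a (q a) b (q b)) :
    CliqueOn R J (Function.update q i w) := by
  intro a ha b hb hab
  by_cases hai : a = i
  · subst hai
    have hba : b ≠ a := hab.symm
    simpa [Function.update_of_ne hba] using hw b hba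
  · by_cases hbi : b = i
    · subst hbi
      simpa [Function.update_of_ne hab] using hR _ _ _ _ (hw a hab)
    · simpa [Function.update_of_ne hai, Function.update_of_ne hbi] using hq a ha b hb hab hai hbi

open Classical in
theorem JoinDense.exists_cliqueOn {s D : ℕ} (hB : JoinDense R s D) (hs : 0 < s) (hk : 0 < k)
    (hR : ∀ i a j b, R i a j b → R j b i a) (J : Finset (Fin k)) :
    ∀ A : Fin k → Finset (Fin M), (∀ i, J.card * s + 1 ≤ (A i).card) →
      ∃ q, CliqueOn R J q ∧ ∀ i, q i ∈ A i := by
  induction J using Finset.induction_on with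
  | empty =>
    intro A hA
    have : ∀ i, ∃ a, a ∈ A i := fun i => Finset.card_pos.1 (by have := hA i; omega)
    choose q hq using this
    exact ⟨q, by simp [CliqueOn], hq⟩
  | insert i J hi ih =>
    intro A hA
    rw [Finset.card_insert_of_notMem hi, Nat.add_mul, one_mul] at hA
    obtain ⟨Q, hQ, hc, hQP⟩ := exists_disjoint_tuples (CliqueOn R J) _ hk ih s A
      (fun j => by have := hA j; omega)
    obtain ⟨q, hq, w, hw, hj⟩ := hB.exists_joins hs i hQ (by omega) (W := A i)
      (by have := hA i; nlinarith [Nat.zero_le (J.card * s)])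
    refine ⟨Function.update q i w, CliqueOn.update hR hj ?_, ?_⟩
    · intro a ha b hb hab hai hbi
      exact (hQP q hq).1 a (Finset.mem_of_mem_insert_of_ne ha hai) b
        (Finset.mem_of_mem_insert_of_ne hb hbi) hab
    · intro j
      by_cases hji : j = i
      · subst hji; simpa using hw
      · simpa [Function.update_of_ne hji] using (hQP q hq).2 j

open Classical in
theorem JoinDense.exists_clique {s D : ℕ} (hB : JoinDense R s D) (hs : 0 < s) (hk : 0 < k)
    (hR : ∀ i a j b, R i a j b → R j b i a) (A : Fin k → Finset (Fin M))
    (hA : ∀ i, k * s + 1 ≤ (A i).card) :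
    ∃ q, CliqueOn R Finset.univ q ∧ ∀ i, q i ∈ A i :=
  hB.exists_cliqueOn hs hk hR Finset.univ A (by simpa using hA)

open Classical in
/-- Few vertices join few tuples of a large disjoint family. -/
theorem JoinDense.card_poor_vertices {s D : ℕ} (hB : JoinDense R s D) (hs : 0 < s) (i : Fin k)
    {Q : Finset (Fin k → Fin M)} (hQ : TuplesDisjoint Q) (hQs : s ≤ Q.card)
    (W : Finset (Fin M)) :
    (W.filter (fun w => D * (Q.filter (fun q => Joins R i w q)).card < Q.card)).card < s := by
  by_contra hc
  push Not at hc
  set X := W.filter (fun w => D * (Q.filter (fun q => Joins R i w q)).card < Q.card) with hX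
  have h := hB i Q X hQ hQs hc
  rw [Finset.card_filter (fun p : (Fin k → Fin M) × Fin M => Joins R i p.2 p.1),
    Finset.sum_product_right, Finset.mul_sum] at h
  have hlt : ∑ w ∈ X, D * ∑ q ∈ Q, (if Joins R i w q then 1 else 0) < ∑ w ∈ X, Q.card := by
    refine Finset.sum_lt_sum_of_nonempty (Finset.card_pos.1 (by omega)) ?_
    intro w hw
    rw [hX, Finset.mem_filter, Finset.card_filter] at hw
    exact hw.2
  rw [Finset.sum_const, smul_eq_mul] at hlt
  rw [mul_comm] at h
  exact absurd hlt (not_lt.2 h)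

open Classical in
/-- Few tuples of a disjoint family are joined by few vertices of a large set. -/
theorem JoinDense.card_poor_tuples {s D : ℕ} (hB : JoinDense R s D) (hs : 0 < s) (i : Fin k)
    {Q : Finset (Fin k → Fin M)} (hQ : TuplesDisjoint Q)
    {W : Finset (Fin M)} (hWs : s ≤ W.card) :
    (Q.filter (fun q => D * (W.filter (fun w => Joins R i w q)).card < W.card)).card < s := by
  by_contra hc
  push Not at hc
  set X := Q.filter (fun q => D * (W.filter (fun w => Joins R i w q)).card < W.card) with hX
  have h := hB i X W (hQ.mono (Finset.filter_subset _ _)) hc hWs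
  rw [Finset.card_filter (fun p : (Fin k → Fin M) × Fin M => Joins R i p.2 p.1),
    Finset.sum_product, Finset.mul_sum] at h
  have hlt : ∑ q ∈ X, D * ∑ w ∈ W, (if Joins R i w q then 1 else 0) < ∑ q ∈ X, W.card := by
    refine Finset.sum_lt_sum_of_nonempty (Finset.card_pos.1 (by omega)) ?_
    intro q hq
    rw [hX, Finset.mem_filter, Finset.card_filter] at hq
    exact hq.2
  rw [Finset.sum_const, smul_eq_mul] at hlt
  exact absurd hlt (not_lt.2 h)

open Classical in
/-- Hall's theorem for tuples against vertices of one part. -/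
theorem JoinDense.exists_matching {s D : ℕ} (hB : JoinDense R s D) (hs : 0 < s) (i : Fin k)
    {Q : Finset (Fin k → Fin M)} (hQ : TuplesDisjoint Q) {W : Finset (Fin M)}
    (hcard : Q.card = W.card)
    (hQdeg : ∀ q ∈ Q, s ≤ (W.filter (fun w => Joins R i w q)).card)
    (hWdeg : ∀ w ∈ W, s ≤ (Q.filter (fun q => Joins R i w q)).card) :
    ∃ g : (Fin k → Fin M) → Fin M, Set.InjOn g Q ∧ ∀ q ∈ Q, g q ∈ W ∧ Joins R i (g q) q := by
  let N : Q → Finset (Fin M) := fun q => W.filter (fun w => Joins R i w q)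
  have hall : ∀ S : Finset Q, S.card ≤ (S.biUnion N).card := by
    intro S
    by_contra hlt
    push Not at hlt
    set S' : Finset (Fin k → Fin M) := S.map (Function.Embedding.subtype _) with hS'
    have hS'card : S'.card = S.card := Finset.card_map _
    have hS'Q : S' ⊆ Q := by
      intro q hq
      obtain ⟨a, -, rfl⟩ := Finset.mem_map.1 hq
      exact a.2
    have hNW : S.biUnion N ⊆ W := Finset.biUnion_subset.2 fun q _ => Finset.filter_subset _ _
    set B := W \ S.biUnion N with hBdef
    have hBcard : B.card = W.card - (S.biUnion N).card := Finset.card_sdiff_of_subset hNW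
    have hSne : S.Nonempty := Finset.card_pos.1 (by omega)
    have hSle : S'.card ≤ Q.card := Finset.card_le_card hS'Q
    obtain ⟨q₀, hq₀⟩ := hSne
    have hSs : s ≤ S'.card := by
      have h1 := hQdeg q₀ q₀.2
      have h2 : (N q₀).card ≤ (S.biUnion N).card :=
        Finset.card_le_card (Finset.subset_biUnion_of_mem N hq₀)
      have h3 : (N q₀).card = (W.filter (fun w => Joins R i w q₀)).card := rfl
      omega
    have hno : ∀ q ∈ S', ∀ w ∈ B, ¬ Joins R i w q := by
      intro q hq w hw hj
      obtain ⟨a, ha, rfl⟩ := Finset.mem_map.1 hq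
      rw [hBdef, Finset.mem_sdiff] at hw
      exact hw.2 (Finset.mem_biUnion.2 ⟨a, ha, Finset.mem_filter.2 ⟨hw.1, hj⟩⟩)
    have hBne : B.Nonempty := Finset.card_pos.1 (by omega)
    obtain ⟨w₀, hw₀⟩ := hBne
    have hBs : s ≤ B.card := by
      have h1 := hWdeg w₀ (Finset.mem_sdiff.1 hw₀).1
      have h2 : (Q.filter (fun q => Joins R i w₀ q)).card ≤ (Q \ S').card := by
        refine Finset.card_le_card fun q hq => ?_
        rw [Finset.mem_filter] at hq
        exact Finset.mem_sdiff.2 ⟨hq.1, fun h => hno q h w₀ hw₀ hq.2⟩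
      rw [Finset.card_sdiff_of_subset hS'Q] at h2
      omega
    obtain ⟨q, hq, w, hw, hj⟩ := hB.exists_joins hs i (hQ.mono hS'Q) hSs hBs
    exact hno q hq w hw hj
  obtain ⟨f, hf, hfN⟩ := (Finset.all_card_le_biUnion_card_iff_exists_injective N).1 hall
  by_cases hM : Nonempty (Fin M)
  · refine ⟨fun q => if h : q ∈ Q then f ⟨q, h⟩ else Classical.arbitrary _, ?_, ?_⟩
    · intro q hq q' hq' e
      have hq1 : q ∈ Q := hq
      have hq2 : q' ∈ Q := hq'
      simp only [hq1, hq2, dif_pos] at e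
      simpa using hf e
    · intro q hq
      have := hfN ⟨q, hq⟩
      simp only [hq, dif_pos]
      exact Finset.mem_filter.1 this
  · exact ⟨fun q => (hM ⟨q i⟩).elim, fun q _ => (hM ⟨q i⟩).elim, fun q _ => (hM ⟨q i⟩).elim⟩

open Classical in
/-- The number of neighbours of `(j, a)` in part `i`. -/
noncomputable def partDegree (R : Fin k → Fin M → Fin k → Fin M → Prop) (j : Fin k) (a : Fin M)
    (i : Fin k) : ℕ :=
  (Finset.univ.filter (fun b => R j a i b)).card

open Classical in
theorem exists_good_sets (d : ℕ)
    (hdeg : ∀ i j j' a a', j ≠ i → j' ≠ i → (j, a) ≠ (j', a') →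
      d ≤ partDegree R j a i ∨ d ≤ partDegree R j' a' i) :
    ∃ G : Fin k → Finset (Fin M), (∀ j, (G j).card = M + 1 - k) ∧
      ∀ j, ∀ a ∈ G j, ∀ i, i ≠ j → d ≤ partDegree R j a i := by
  have key : ∀ j, ∃ A : Finset (Fin M), A.card = M + 1 - k ∧
      ∀ a ∈ A, ∀ i, i ≠ j → d ≤ partDegree R j a i := by
    intro j
    set bad := (Finset.univ : Finset (Fin M)).filter
      (fun a => ∃ i, i ≠ j ∧ partDegree R j a i < d) with hbad
    have hch : ∀ a ∈ bad, ∃ i, i ≠ j ∧ partDegree R j a i < d := fun a ha =>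
      (Finset.mem_filter.1 ha).2
    have : Nonempty (Fin k) := ⟨j⟩
    choose! c hc using hch
    have hle : bad.card ≤ (Finset.univ.erase j).card := by
      refine Finset.card_le_card_of_injOn c
        (fun a ha => Finset.mem_coe.2 (Finset.mem_erase.2 ⟨(hc a ha).1, Finset.mem_univ _⟩)) ?_
      intro a ha b hb hab
      by_contra hne
      have h1 := hc a ha
      have h2 := hc b hb
      rw [← hab] at h2
      rcases hdeg (c a) j j a b h1.1.symm h1.1.symm (by simpa using hne) with h | h
      · exact absurd h (not_le.2 h1.2)
      · exact absurd h (not_le.2 h2.2)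
    rw [Finset.card_erase_of_mem (Finset.mem_univ _), Finset.card_univ, Fintype.card_fin] at hle
    have hj := j.2
    obtain ⟨A, hA, hAc⟩ := Finset.exists_subset_card_eq (s := badᶜ) (n := M + 1 - k) (by
      rw [Finset.card_compl, Fintype.card_fin]; omega)
    refine ⟨A, hAc, fun a ha i hi => ?_⟩
    have := hA ha
    rw [Finset.mem_compl, hbad, Finset.mem_filter] at this
    by_contra hlt
    exact this ⟨Finset.mem_univ _, i, hi, not_le.1 hlt⟩
  choose G hG using key
  exact ⟨G, fun j => (hG j).1, fun j => (hG j).2⟩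

open Classical in
/-- Vertices of large degree can be covered by disjoint cliques. -/
theorem exists_cover (hR : ∀ i a j b, R i a j b → R j b i a) (L t : ℕ)
    (hA : ∀ A : Fin k → Finset (Fin M), (∀ i, L ≤ (A i).card) →
      ∃ q, CliqueOn R Finset.univ q ∧ ∀ i, q i ∈ A i) (hLM : L ≤ M)
    (G U : Fin k → Finset (Fin M)) (X : Finset (Fin k × Fin M)) :
    X.card ≤ t → (∀ x ∈ X, x.2 ∈ G x.1) →
    (∀ x ∈ X, ∀ j, j ≠ x.1 → L + t ≤ (((G j).filter (fun b => R x.1 x.2 j b)) \ U j).card) →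
    ∃ Q, TuplesDisjoint Q ∧ Q.card ≤ X.card ∧ (∀ x ∈ X, ∃ q ∈ Q, q x.1 = x.2) ∧
      ∀ q ∈ Q, CliqueOn R Finset.univ q ∧ ∀ j, q j ∈ G j ∧ ((j, q j) ∈ X ∨ q j ∉ U j) := by
  induction X using Finset.induction_on with
  | empty => exact fun _ _ _ => ⟨∅, by simp [TuplesDisjoint], by simp, by simp, by simp⟩
  | insert x X hx ih =>
    intro hc hG hd
    rw [Finset.card_insert_of_notMem hx] at hc
    obtain ⟨Q, hQ, hQc, hQX, hQP⟩ := ih (by omega)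
      (fun y hy => hG y (Finset.mem_insert_of_mem hy))
      (fun y hy => hd y (Finset.mem_insert_of_mem hy))
    have hQP' : ∀ q ∈ Q, CliqueOn R Finset.univ q ∧
        ∀ j, q j ∈ G j ∧ ((j, q j) ∈ insert x X ∨ q j ∉ U j) := fun q hq =>
      ⟨(hQP q hq).1, fun j => ⟨((hQP q hq).2 j).1,
        ((hQP q hq).2 j).2.imp Finset.mem_insert_of_mem id⟩⟩
    by_cases hcov : ∃ q ∈ Q, q x.1 = x.2
    · refine ⟨Q, hQ, hQc.trans (Finset.card_le_card (Finset.subset_insert _ _)), ?_, hQP'⟩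
      intro y hy
      rcases Finset.mem_insert.1 hy with rfl | hy
      · exact hcov
      · exact hQX y hy
    · obtain ⟨q, hq, hqA⟩ := hA (fun j => if j = x.1 then Finset.univ else
          (((G j).filter (fun b => R x.1 x.2 j b)) \ U j) \ Q.image (fun q => q j)) (by
        intro j
        by_cases hj : j = x.1
        · simp [hj, hLM]
        · simp only [hj, if_false]
          have h1 := hd x (Finset.mem_insert_self _ _) j hj
          have h2 := Finset.le_card_sdiff (Q.image (fun q => q j))
            (((G j).filter (fun b => R x.1 x.2 j b)) \ U j)
          rw [hQ.card_image j] at h2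
          omega)
      have hqj : ∀ j, j ≠ x.1 → q j ∈ G j ∧ R x.1 x.2 j (q j) ∧ q j ∉ U j ∧
          q j ∉ Q.image (fun q => q j) := by
        intro j hj
        have := hqA j
        rw [if_neg hj, Finset.mem_sdiff, Finset.mem_sdiff, Finset.mem_filter] at this
        tauto
      have hnew : ∀ j, Function.update q x.1 x.2 j ∉ Q.image (fun q' => q' j) := by
        intro j
        by_cases hj : j = x.1
        · subst hj
          intro h
          obtain ⟨q', hq', e⟩ := Finset.mem_image.1 h
          exact hcov ⟨q', hq', by simpa using e⟩
        · rw [Function.update_of_ne hj]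
          exact (hqj j hj).2.2.2
      refine ⟨insert (Function.update q x.1 x.2) Q, hQ.insert hnew, ?_, ?_, ?_⟩
      · rw [Finset.card_insert_of_notMem hx]
        exact (Finset.card_insert_le _ _).trans (by omega)
      · intro y hy
        rcases Finset.mem_insert.1 hy with rfl | hy
        · exact ⟨_, Finset.mem_insert_self _ _, by simp⟩
        · obtain ⟨q', hq', e⟩ := hQX y hy
          exact ⟨q', Finset.mem_insert_of_mem hq', e⟩
      · intro q' hq'
        rcases Finset.mem_insert.1 hq' with rfl | hq'
        · refine ⟨CliqueOn.update hR (fun j hj => (hqj j hj).2.1)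
            (fun a ha b hb hab _ _ => hq a ha b hb hab), fun j => ?_⟩
          by_cases hj : j = x.1
          · subst hj
            simpa using hG x (Finset.mem_insert_self _ _)
          · rw [Function.update_of_ne hj]
            exact ⟨(hqj j hj).1, Or.inr (hqj j hj).2.2.1⟩
        · exact hQP' q' hq'

open Classical in
theorem exists_fibers_card_eq {α : Type*} (k τ : ℕ) (hk : 0 < k) (Q : Finset α)
    (hQ : Q.card = k * τ) : ∃ o : α → Fin k, ∀ i, (Q.filter (fun q => o q = i)).card = τ := by
  have e : Q ≃ Fin k × Fin τ := Fintype.equivOfCardEq (by simp [hQ])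
  refine ⟨fun q => if h : q ∈ Q then (e ⟨q, h⟩).1 else ⟨0, hk⟩, fun i => ?_⟩
  have : Q.filter (fun q => (if h : q ∈ Q then (e ⟨q, h⟩).1 else ⟨0, hk⟩) = i) =
      (Finset.univ : Finset (Fin τ)).image (fun b => (e.symm (i, b) : α)) := by
    ext q
    simp only [Finset.mem_filter, Finset.mem_image, Finset.mem_univ, true_and]
    constructor
    · rintro ⟨hq, h⟩
      rw [dif_pos hq] at h
      exact ⟨(e ⟨q, hq⟩).2, by rw [← h]; simp⟩
    · rintro ⟨b, rfl⟩
      simp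
  rw [this, Finset.card_image_of_injective, Finset.card_univ, Fintype.card_fin]
  intro b b' h
  simpa using h

open Classical in
theorem exists_disjoint_cliques (hk : 2 ≤ k) (hR : ∀ i a j b, R i a j b → R j b i a)
    {s D d : ℕ} (hs : 0 < s) (hD : 0 < D) (hd : 10 * (D * k ^ 2 * s) ≤ d) (hM : d ≤ M)
    (hB : JoinDense R s D)
    (hdeg : ∀ i j j' a a', j ≠ i → j' ≠ i → (j, a) ≠ (j', a') →
      d ≤ partDegree R j a i ∨ d ≤ partDegree R j' a' i) :
    ∃ Q : Finset (Fin k → Fin M), TuplesDisjoint Q ∧ Q.card = M + 1 - k ∧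
      ∀ q ∈ Q, CliqueOn R Finset.univ q := by
  have hk0 : 0 < k := by omega
  obtain ⟨G, hGc, hGd⟩ := exists_good_sets d hdeg
  set m := M + 1 - k with hm
  set L := k * s + 1 with hL
  set τ := 4 * (D * k * s) with hτ
  -- numerical facts
  have hks : 2 * s ≤ k * s := Nat.mul_le_mul_right _ hk
  have hkks : k ≤ k * s := Nat.le_mul_of_pos_right _ hs
  have hDks : k * s ≤ D * k * s := by
    rw [mul_assoc]; exact Nat.le_mul_of_pos_left _ hD
  have hkτ : k * τ = 4 * (D * k ^ 2 * s) := by rw [hτ]; ring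
  have hDk2 : 2 * (D * k * s) ≤ D * k ^ 2 * s := by
    have : D * k ^ 2 * s = k * (D * k * s) := by ring
    rw [this]; exact Nat.mul_le_mul_right _ hk
  have hclq := hB.exists_clique hs hk0 hR
  obtain ⟨Q₀, hQ₀, hQ₀c, hQ₀P⟩ := exists_disjoint_tuples (CliqueOn R Finset.univ) L hk0 hclq
    (k * τ) G (fun i => by rw [hGc]; omega)
  obtain ⟨o, ho⟩ := exists_fibers_card_eq k τ hk0 Q₀ hQ₀c
  set T : Fin k → Finset (Fin k → Fin M) := fun i => Q₀.filter (fun q => o q = i) with hT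
  have hTQ : ∀ i, T i ⊆ Q₀ := fun i => Finset.filter_subset _ _
  have hTd : ∀ i, TuplesDisjoint (T i) := fun i => hQ₀.mono (hTQ i)
  set U : Fin k → Finset (Fin M) := fun j => Q₀.image (fun q => q j) with hU
  have hUc : ∀ j, (U j).card = k * τ := fun j => (hQ₀.card_image j).trans hQ₀c
  set X : Fin k → Finset (Fin M) := fun i =>
    (G i).filter (fun w => D * ((T i).filter (fun q => Joins R i w q)).card < (T i).card) with hX
  have hsτ : s ≤ τ := by omega
  have hXc : ∀ i, (X i).card < s := fun i =>
    hB.card_poor_vertices hs i (hTd i) (by rw [ho]; exact hsτ) (G i)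
  set Xs : Finset (Fin k × Fin M) :=
    Finset.univ.biUnion (fun i => (X i).image (fun a => (i, a))) with hXs
  have hXsmem : ∀ j a, (j, a) ∈ Xs ↔ a ∈ X j := by
    intro j a
    simp only [hXs, Finset.mem_biUnion, Finset.mem_image, Finset.mem_univ, true_and, Prod.mk.injEq]
    constructor
    · rintro ⟨i, b, hb, rfl, rfl⟩; exact hb
    · exact fun h => ⟨j, a, h, rfl, rfl⟩
  have hXsc : Xs.card ≤ k * s := by
    refine Finset.card_biUnion_le.trans ?_
    calc ∑ i, ((X i).image (fun a => (i, a))).card ≤ ∑ _i : Fin k, s :=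
          Finset.sum_le_sum fun i _ => Finset.card_image_le.trans (hXc i).le
      _ = k * s := by simp
  obtain ⟨C, hC, hCc, hCX, hCP⟩ := exists_cover hR L (k * s) hclq (by omega) G U Xs hXsc
    (by
      rintro ⟨j, a⟩ hx
      exact (Finset.mem_filter.1 ((hXsmem j a).1 hx)).1)
    (by
      rintro ⟨i, a⟩ hx j hj
      have haG : a ∈ G i := (Finset.mem_filter.1 ((hXsmem i a).1 hx)).1
      have h1 := hGd i a haG j hj
      rw [partDegree] at h1
      have h2 : (Finset.univ.filter (fun b => R i a j b)).card ≤
          ((G j).filter (fun b => R i a j b)).card + (G j)ᶜ.card := by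
        refine (Finset.card_le_card ?_).trans (Finset.card_union_le _ _)
        intro b hb
        rw [Finset.mem_filter] at hb
        by_cases hbG : b ∈ G j
        · exact Finset.mem_union_left _ (Finset.mem_filter.2 ⟨hbG, hb.2⟩)
        · exact Finset.mem_union_right _ (Finset.mem_compl.2 hbG)
      rw [Finset.card_compl, Fintype.card_fin, hGc] at h2
      have h3 := Finset.le_card_sdiff (U j) ((G j).filter (fun b => R i a j b))
      rw [hUc] at h3
      simp only
      omega)
  set E : Fin k → Finset (Fin M) := fun i => (T i).image (fun q => q i) with hE
  have hEc : ∀ i, (E i).card = τ := fun i => ((hTd i).card_image i).trans (ho i)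
  set Y : Fin k → Finset (Fin k → Fin M) := fun i =>
    (T i).filter (fun q => D * ((E i).filter (fun w => Joins R i w q)).card < (E i).card) with hY
  have hYc : ∀ i, (Y i).card < s := fun i =>
    hB.card_poor_tuples hs i (hTd i) (by rw [hEc]; exact hsτ)
  -- the usable tuples
  set T' : Finset (Fin k → Fin M) := Q₀.filter (fun q => q ∉ Y (o q) ∧ ∀ j, q j ∉ X j) with hT'
  have hT'Q : T' ⊆ Q₀ := Finset.filter_subset _ _
  have hT'd : TuplesDisjoint T' := hQ₀.mono hT'Q
  set S : Fin k → Finset (Fin k → Fin M) := fun i => T'.filter (fun q => o q = i) with hS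
  have hST' : ∀ i, S i ⊆ T' := fun i => Finset.filter_subset _ _
  have hSd : ∀ i, TuplesDisjoint (S i) := fun i => hT'd.mono (hST' i)
  have hST : ∀ i, S i ⊆ T i := fun i => Finset.filter_subset_filter _ hT'Q
  have hTS : ∀ i, (T i \ S i).card ≤ s + k * s := by
    intro i
    have hsub : T i \ S i ⊆ Y i ∪ Finset.univ.biUnion (fun j => (T i).filter (fun q => q j ∈ X j)) := by
      intro q hq
      rw [Finset.mem_sdiff] at hq
      obtain ⟨hqT, hqS⟩ := hq
      have hq1 := Finset.mem_filter.1 hqT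
      by_cases hqY : q ∈ Y i
      · exact Finset.mem_union_left _ hqY
      · refine Finset.mem_union_right _ ?_
        by_contra hno
        apply hqS
        refine Finset.mem_filter.2 ⟨Finset.mem_filter.2 ⟨hq1.1, ?_, ?_⟩, hq1.2⟩
        · rw [hq1.2]; exact hqY
        · intro j hj
          exact hno (Finset.mem_biUnion.2 ⟨j, Finset.mem_univ _, Finset.mem_filter.2 ⟨hqT, hj⟩⟩)
    refine (Finset.card_le_card hsub).trans ((Finset.card_union_le _ _).trans ?_)
    refine Nat.add_le_add (hYc i).le (Finset.card_biUnion_le.trans ?_)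
    calc ∑ j, ((T i).filter (fun q => q j ∈ X j)).card ≤ ∑ _j : Fin k, s := by
          refine Finset.sum_le_sum fun j _ => le_trans ?_ (hXc j).le
          refine Finset.card_le_card_of_injOn (fun q => q j)
            (fun q hq => (Finset.mem_filter.1 hq).2) ?_
          exact ((hTd i).mono (Finset.filter_subset _ _)).injOn j
      _ = k * s := by simp
  have hSc : ∀ i, τ ≤ (S i).card + (s + k * s) := by
    intro i
    have h1 := hTS i
    rw [Finset.card_sdiff_of_subset (hST i), ho] at h1
    omega
  have hCT' : ∀ q ∈ C, ∀ q' ∈ T', ∀ j, q j ≠ q' j := by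
    intro q hq q' hq' j e
    have hq'' := Finset.mem_filter.1 hq'
    rcases ((hCP q hq).2 j).2 with h | h
    · rw [hXsmem, e] at h
      exact hq''.2.2 j h
    · exact h (Finset.mem_image.2 ⟨q', hq''.1, e.symm⟩)
  set A := C ∪ T' with hA
  have hAd : TuplesDisjoint A := hC.union hT'd hCT'
  have hAc : A.card = C.card + T'.card := by
    refine Finset.card_union_of_disjoint (Finset.disjoint_left.2 fun q h1 h2 => ?_)
    exact hCT' q h1 q h2 ⟨0, hk0⟩ rfl
  have hAG : ∀ j, A.image (fun q => q j) ⊆ G j := by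
    intro j a ha
    obtain ⟨q, hq, rfl⟩ := Finset.mem_image.1 ha
    rcases Finset.mem_union.1 hq with hq | hq
    · exact ((hCP q hq).2 j).1
    · exact (hQ₀P q (hT'Q hq)).2 j
  have hT'c : T'.card ≤ k * τ := (Finset.card_le_card hT'Q).trans hQ₀c.le
  set t := m - A.card with ht
  have hAm : A.card ≤ m := by omega
  set F : Fin k → Finset (Fin M) := fun j => G j \ A.image (fun q => q j) with hF
  have hFc : ∀ j, (F j).card = t := by
    intro j
    rw [Finset.card_sdiff_of_subset (hAG j), hAd.card_image, hGc]
  set V : Fin k → Finset (Fin M) := fun j => (S j).image (fun q => q j) with hV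
  have hVc : ∀ j, (V j).card = (S j).card := fun j => (hSd j).card_image j
  have hVE : ∀ j, V j ⊆ E j := fun j => Finset.image_subset_image (hST j)
  have hFV : ∀ j, Disjoint (F j) (V j) := by
    intro j
    refine Finset.disjoint_left.2 fun a ha hb => (Finset.mem_sdiff.1 ha).2 ?_
    obtain ⟨q, hq, rfl⟩ := Finset.mem_image.1 hb
    exact Finset.mem_image_of_mem _ (Finset.mem_union_right _ (hST' j hq))
  have hVG : ∀ j, V j ⊆ G j := by
    intro j a ha
    obtain ⟨q, hq, rfl⟩ := Finset.mem_image.1 ha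
    exact (hQ₀P q (hT'Q (hST' j hq))).2 j
  have hV'ex : ∀ j, ∃ B ⊆ V j, B.card = (S j).card - L := fun j =>
    Finset.exists_subset_card_eq (by rw [hVc]; omega)
  choose V' hV'V hV'c using hV'ex
  have hLS : ∀ j, L ≤ (S j).card := by
    intro j
    have := hSc j
    omega
  -- the near-perfect tiling
  obtain ⟨Z, hZ, hZc, hZP⟩ := exists_disjoint_tuples (CliqueOn R Finset.univ) L hk0 hclq
    t (fun j => F j ∪ (V j \ V' j)) (fun j => by
      rw [Finset.card_union_of_disjoint
        (Finset.disjoint_of_subset_right Finset.sdiff_subset (hFV j)), hFc,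
        Finset.card_sdiff_of_subset (hV'V j), hVc, hV'c]
      have := hLS j
      omega)
  have hZsub : ∀ j, Z.image (fun q => q j) ⊆ F j ∪ (V j \ V' j) := by
    intro j a ha
    obtain ⟨q, hq, rfl⟩ := Finset.mem_image.1 ha
    exact (hZP q hq).2 j
  set W : Fin k → Finset (Fin M) := fun j => (F j ∪ V j) \ Z.image (fun q => q j) with hW
  have hWc : ∀ j, (S j).card = (W j).card := by
    intro j
    rw [Finset.card_sdiff_of_subset ((hZsub j).trans
      (Finset.union_subset_union_right Finset.sdiff_subset)), hZ.card_image, hZc,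
      Finset.card_union_of_disjoint (hFV j), hFc, hVc]
    omega
  have hV'W : ∀ j, V' j ⊆ W j := by
    intro j a ha
    refine Finset.mem_sdiff.2 ⟨Finset.mem_union_right _ (hV'V j ha), fun hz => ?_⟩
    rcases Finset.mem_union.1 (hZsub j hz) with h | h
    · exact Finset.disjoint_left.1 (hFV j) h (hV'V j ha)
    · exact (Finset.mem_sdiff.1 h).2 ha
  have h4 : ∀ x, τ ≤ D * x → 4 * (k * s) ≤ x := by
    intro x hx
    have : D * (4 * (k * s)) ≤ D * x := by
      refine le_trans (le_of_eq ?_) hx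
      rw [hτ]; ring
    exact Nat.le_of_mul_le_mul_left this hD
  have hmatch : ∀ j, ∃ g : (Fin k → Fin M) → Fin M, Set.InjOn g (S j) ∧
      ∀ q ∈ S j, g q ∈ W j ∧ Joins R j (g q) q := by
    intro j
    refine hB.exists_matching hs j (hSd j) (hWc j) ?_ ?_
    · intro q hq
      have hqT' := Finset.mem_filter.1 (hST' j hq)
      have hoq : o q = j := (Finset.mem_filter.1 hq).2
      have hqY : q ∉ Y j := hoq ▸ hqT'.2.1
      have hdegq : τ ≤ D * ((E j).filter (fun w => Joins R j w q)).card := by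
        by_contra hlt
        exact hqY (Finset.mem_filter.2 ⟨hST j hq, by rw [hEc]; exact not_le.1 hlt⟩)
      have h1 := h4 _ hdegq
      have h2 : ((E j).filter (fun w => Joins R j w q)).card ≤
          ((W j).filter (fun w => Joins R j w q)).card + (E j \ V' j).card := by
        refine (Finset.card_le_card ?_).trans (Finset.card_union_le _ _)
        intro w hw
        rw [Finset.mem_filter] at hw
        by_cases hwV : w ∈ V' j
        · exact Finset.mem_union_left _ (Finset.mem_filter.2 ⟨hV'W j hwV, hw.2⟩)
        · exact Finset.mem_union_right _ (Finset.mem_sdiff.2 ⟨hw.1, hwV⟩)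
      rw [Finset.card_sdiff_of_subset ((hV'V j).trans (hVE j)), hEc, hV'c] at h2
      have := hSc j
      omega
    · intro w hw
      have hwX : w ∉ X j := by
        rcases Finset.mem_union.1 (Finset.mem_sdiff.1 hw).1 with h | h
        · intro hwX
          obtain ⟨q, hq, e⟩ := hCX (j, w) ((hXsmem j w).2 hwX)
          exact (Finset.mem_sdiff.1 h).2 (Finset.mem_image.2 ⟨q, Finset.mem_union_left _ hq, e⟩)
        · obtain ⟨q, hq, rfl⟩ := Finset.mem_image.1 h
          exact (Finset.mem_filter.1 (hST' j hq)).2.2 j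
      have hwG : w ∈ G j := by
        rcases Finset.mem_union.1 (Finset.mem_sdiff.1 hw).1 with h | h
        · exact (Finset.mem_sdiff.1 h).1
        · exact hVG j h
      have hdegw : τ ≤ D * ((T j).filter (fun q => Joins R j w q)).card := by
        by_contra hlt
        exact hwX (Finset.mem_filter.2 ⟨hwG, by rw [ho]; exact not_le.1 hlt⟩)
      have h1 := h4 _ hdegw
      have h2 : ((T j).filter (fun q => Joins R j w q)).card ≤
          ((S j).filter (fun q => Joins R j w q)).card + (T j \ S j).card := by
        refine (Finset.card_le_card ?_).trans (Finset.card_union_le _ _)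
        intro q hq
        rw [Finset.mem_filter] at hq
        by_cases hqS : q ∈ S j
        · exact Finset.mem_union_left _ (Finset.mem_filter.2 ⟨hqS, hq.2⟩)
        · exact Finset.mem_union_right _ (Finset.mem_sdiff.2 ⟨hq.1, hqS⟩)
      have := hTS j
      omega
  choose g hgi hgW using hmatch
  have hmS : ∀ q ∈ T', q ∈ S (o q) := fun q hq => Finset.mem_filter.2 ⟨hq, rfl⟩
  set φ : (Fin k → Fin M) → (Fin k → Fin M) := fun q =>
    Function.update q (o q) (g (o q) q) with hφ
  -- replaced vertices avoid the other families
  have hWA : ∀ q ∈ T', ∀ w ∈ W (o q), ∀ q' ∈ C, q' (o q) ≠ w := by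
    intro q hq w hw q' hq' e
    rcases Finset.mem_union.1 (Finset.mem_sdiff.1 hw).1 with h | h
    · exact (Finset.mem_sdiff.1 h).2 (Finset.mem_image.2 ⟨q', Finset.mem_union_left _ hq', e⟩)
    · obtain ⟨q'', hq'', e'⟩ := Finset.mem_image.1 h
      exact hCT' q' hq' q'' (hST' _ hq'') (o q) (e.trans e'.symm)
  have hWT : ∀ i, ∀ w ∈ W i, ∀ q' ∈ T', o q' ≠ i → q' i ≠ w := by
    intro i w hw q' hq' hne e
    rcases Finset.mem_union.1 (Finset.mem_sdiff.1 hw).1 with h | h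
    · exact (Finset.mem_sdiff.1 h).2 (Finset.mem_image.2 ⟨q', Finset.mem_union_right _ hq', e⟩)
    · obtain ⟨q'', hq'', e'⟩ := Finset.mem_image.1 h
      refine hT'd q' hq' q'' (hST' _ hq'') ?_ i (e.trans e'.symm)
      rintro rfl
      exact hne (Finset.mem_filter.1 hq'').2
  have hφne : ∀ q ∈ T', ∀ q' ∈ T', q ≠ q' → ∀ j, φ q j ≠ φ q' j := by
    intro q hq q' hq' hne j
    by_cases h1 : j = o q
    · by_cases h2 : j = o q'
      · have ho' : o q' = o q := h2.symm.trans h1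
        simp only [hφ, ho', h1, Function.update_self]
        exact fun e => hne (hgi _ (hmS q hq) (ho' ▸ hmS q' hq') e)
      · simp only [hφ, Function.update_of_ne h2]
        subst h1
        rw [Function.update_self]
        exact (hWT _ _ (hgW _ q (hmS q hq)).1 q' hq' (Ne.symm h2)).symm
    · by_cases h2 : j = o q'
      · simp only [hφ, Function.update_of_ne h1]
        subst h2
        rw [Function.update_self]
        exact hWT _ _ (hgW _ q' (hmS q' hq')).1 q hq (Ne.symm h1)
      · simp only [hφ, Function.update_of_ne h1, Function.update_of_ne h2]
        exact hT'd q hq q' hq' hne j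
  have hZA : ∀ q ∈ Z, ∀ q' ∈ A, ∀ j, q j = q' j → q' ∈ S j ∧ q j ∉ W j := by
    intro q hq q' hq' j e
    have hqW : q j ∉ W j := fun h => (Finset.mem_sdiff.1 h).2 (Finset.mem_image_of_mem _ hq)
    refine ⟨?_, hqW⟩
    rcases Finset.mem_union.1 (hZsub j (Finset.mem_image_of_mem _ hq)) with h | h
    · exact absurd (Finset.mem_image.2 ⟨q', hq', e.symm⟩) (Finset.mem_sdiff.1 h).2
    · obtain ⟨q'', hq'', e'⟩ := Finset.mem_image.1 (Finset.mem_sdiff.1 h).1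
      by_cases hqq : q' = q''
      · exact hqq ▸ hq''
      · exact absurd (e.symm.trans e'.symm)
          (hAd q' hq' q'' (Finset.mem_union_right _ (hST' _ hq'')) hqq j)
  have hCZ : ∀ q ∈ C, ∀ q' ∈ Z, ∀ j, q j ≠ q' j := by
    intro q hq q' hq' j e
    have := (hZA q' hq' q (Finset.mem_union_left _ hq) j e.symm).1
    exact hCT' q hq q (hST' _ this) j rfl
  have hCφ : ∀ q ∈ C ∪ Z, ∀ q' ∈ T'.image φ, ∀ j, q j ≠ q' j := by
    intro q hq q'' hq'' j
    obtain ⟨q', hq', rfl⟩ := Finset.mem_image.1 hq''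
    have hq'W := (hgW _ q' (hmS q' hq')).1
    by_cases h : j = o q'
    · subst h
      simp only [hφ, Function.update_self]
      rcases Finset.mem_union.1 hq with hq | hq
      · exact hWA q' hq' _ hq'W q hq
      · intro e
        rw [← e] at hq'W
        exact (Finset.mem_sdiff.1 hq'W).2 (Finset.mem_image_of_mem _ hq)
    · simp only [hφ, Function.update_of_ne h]
      rcases Finset.mem_union.1 hq with hq | hq
      · exact hCT' q hq q' hq' j
      · intro e
        exact h (Finset.mem_filter.1 (hZA q hq q' (Finset.mem_union_right _ hq') j e).1).2.symm
  have hφd : TuplesDisjoint (T'.image φ) := by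
    intro a ha b hb hab
    obtain ⟨q, hq, rfl⟩ := Finset.mem_image.1 ha
    obtain ⟨q', hq', rfl⟩ := Finset.mem_image.1 hb
    exact hφne q hq q' hq' fun h => hab (by rw [h])
  refine ⟨(C ∪ Z) ∪ T'.image φ, (hC.union hZ hCZ).union hφd hCφ, ?_, ?_⟩
  · rw [Finset.card_union_of_disjoint (Finset.disjoint_left.2 fun q h1 h2 =>
        hCφ q h1 q h2 ⟨0, hk0⟩ rfl),
      Finset.card_union_of_disjoint (Finset.disjoint_left.2 fun q h1 h2 =>
        hCZ q h1 q h2 ⟨0, hk0⟩ rfl),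
      Finset.card_image_of_injOn, hZc]
    · omega
    · intro q hq q' hq' e
      by_contra hne
      exact hφne q hq q' hq' hne ⟨0, hk0⟩ (congrFun e _)
  · intro q hq
    rcases Finset.mem_union.1 hq with hq | hq
    · rcases Finset.mem_union.1 hq with hq | hq
      · exact (hCP q hq).1
      · exact (hZP q hq).1
    · obtain ⟨q', hq', rfl⟩ := Finset.mem_image.1 hq
      exact CliqueOn.update hR (hgW _ q' (hmS q' hq')).2
        (fun a ha b hb hab _ _ => (hQ₀P q' (hT'Q hq')).1 a ha b hb hab)

end Tuples

section Blocks

variable {I : Type*} [Fintype I] [DecidableEq I]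

theorem sum_eq_two_mul_sum_fixed (g : (I → Bool) → ℝ) (i : I) (b : Bool)
    (hg : ∀ ω c, g (Function.update ω i c) = g ω) :
    ∑ ω, g ω = 2 * ∑ ω : I → Bool, (if ω i = b then g ω else 0) := by
  have hinv : Function.Involutive (fun ω : I → Bool => Function.update ω i (!ω i)) := by
    intro ω
    simp
  have h1 : ∑ ω : I → Bool, (if ω i = b then 0 else g ω) =
      ∑ ω : I → Bool, (if ω i = b then g ω else 0) := by
    rw [← Equiv.sum_comp hinv.toPerm]
    refine Finset.sum_congr rfl fun ω _ => ?_
    simp only [Function.Involutive.coe_toPerm, Function.update_self, hg]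
    cases ω i <;> cases b <;> simp
  have h2 : ∑ ω, g ω = ∑ ω : I → Bool, (if ω i = b then g ω else 0) +
      ∑ ω : I → Bool, (if ω i = b then 0 else g ω) := by
    rw [← Finset.sum_add_distrib]
    refine Finset.sum_congr rfl fun ω _ => ?_
    split_ifs <;> simp
  rw [h2, h1]; ring

theorem sum_eq_pow_mul_sum_agree (p : I → Bool) (B : Finset I) :
    ∀ g : (I → Bool) → ℝ, (∀ i ∈ B, ∀ ω c, g (Function.update ω i c) = g ω) →
    ∑ ω, g ω = 2 ^ B.card * ∑ ω : I → Bool, (if ∀ i ∈ B, ω i = p i then g ω else 0) := by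
  induction B using Finset.induction_on with
  | empty => intro g _; simp
  | insert i B hi ih =>
    intro g hg
    rw [ih g fun j hj => hg j (Finset.mem_insert_of_mem hj), Finset.card_insert_of_notMem hi,
      sum_eq_two_mul_sum_fixed _ i (p i), pow_succ, mul_assoc]
    · congr 2
      refine Finset.sum_congr rfl fun ω _ => ?_
      by_cases h1 : ω i = p i <;> simp [h1]
    · intro ω c
      rw [hg i (Finset.mem_insert_self _ _)]
      congr 1
      simp only [eq_iff_iff]
      refine forall₂_congr fun j hj => ?_
      rw [Function.update_of_ne (show j ≠ i by rintro rfl; exact hi hj)]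

theorem sum_prod_blocks_le {ι : Type*} [DecidableEq ι] (p : I → Bool) (K : ℕ) (B : ι → Finset I)
    (T : Finset ι) : (∀ t ∈ T, (B t).card ≤ K) →
    (∀ t ∈ T, ∀ t' ∈ T, t ≠ t' → Disjoint (B t) (B t')) →
    ∑ ω : I → Bool, ∏ t ∈ T, (if ∀ i ∈ B t, ω i = p i then (1 / 2 : ℝ) else 1) ≤
      2 ^ Fintype.card I * (1 - 1 / 2 ^ (K + 1)) ^ T.card := by
  induction T using Finset.induction_on with
  | empty => simp
  | insert t T ht ih =>
    intro hK hd
    have ih' := ih (fun t ht => hK t (Finset.mem_insert_of_mem ht))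
      (fun t ht t' ht' => hd t (Finset.mem_insert_of_mem ht) t' (Finset.mem_insert_of_mem ht'))
    set g : (I → Bool) → ℝ := fun ω =>
      ∏ t ∈ T, (if ∀ i ∈ B t, ω i = p i then (1 / 2 : ℝ) else 1) with hg
    have hg0 : 0 ≤ ∑ ω, g ω := Finset.sum_nonneg fun ω _ => Finset.prod_nonneg fun t _ => by
      split_ifs <;> norm_num
    have hind : ∀ i ∈ B t, ∀ ω c, g (Function.update ω i c) = g ω := by
      intro i hi ω c
      refine Finset.prod_congr rfl fun t' ht' => ?_
      congr 1
      simp only [eq_iff_iff]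
      refine forall₂_congr fun j hj => ?_
      rw [Function.update_of_ne]
      rintro rfl
      refine Finset.disjoint_left.1 (hd t (Finset.mem_insert_self _ _) t'
        (Finset.mem_insert_of_mem ht') ?_) hi hj
      rintro rfl
      exact ht ht'
    have h1 := sum_eq_pow_mul_sum_agree p (B t) g hind
    set S := ∑ ω : I → Bool, (if ∀ i ∈ B t, ω i = p i then g ω else 0) with hS
    have hS0 : 0 ≤ S := by
      by_contra h
      have : (0 : ℝ) < 2 ^ (B t).card := by positivity
      nlinarith
    have h2 : ∑ ω : I → Bool, ∏ t ∈ insert t T, (if ∀ i ∈ B t, ω i = p i then (1 / 2 : ℝ) else 1)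
        = ∑ ω, g ω - 1 / 2 * S := by
      rw [hS, Finset.mul_sum, ← Finset.sum_sub_distrib]
      refine Finset.sum_congr rfl fun ω _ => ?_
      rw [Finset.prod_insert ht]
      change _ * g ω = _
      split_ifs <;> ring
    have h3 : ∑ ω, g ω ≤ 2 ^ K * S := by
      rw [h1]
      exact mul_le_mul_of_nonneg_right
        (pow_le_pow_right₀ (by norm_num) (hK t (Finset.mem_insert_self _ _))) hS0
    have h4 : (∑ ω, g ω) * (1 / 2 ^ (K + 1)) ≤ 1 / 2 * S := by
      rw [mul_one_div, div_le_iff₀ (by positivity), pow_succ]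
      linarith
    have h5 : (0 : ℝ) ≤ 1 - 1 / 2 ^ (K + 1) := by
      rw [sub_nonneg, div_le_one (by positivity)]
      exact one_le_pow₀ (by norm_num)
    rw [h2, Finset.card_insert_of_notMem ht, pow_succ, ← mul_assoc]
    calc ∑ ω, g ω - 1 / 2 * S ≤ (∑ ω, g ω) * (1 - 1 / 2 ^ (K + 1)) := by linarith
      _ ≤ _ := mul_le_mul_of_nonneg_right ih' h5

/-- Lower tail for the number of blocks on which a random `ω` agrees with `p`. -/
theorem card_few_blocks_le {ι : Type*} [DecidableEq ι] (p : I → Bool) (K : ℕ) (B : ι → Finset I)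
    (T : Finset ι) (hK : ∀ t ∈ T, (B t).card ≤ K)
    (hd : ∀ t ∈ T, ∀ t' ∈ T, t ≠ t' → Disjoint (B t) (B t')) :
    (((Finset.univ : Finset (I → Bool)).filter (fun ω =>
      2 ^ (K + 1) * (T.filter (fun t => ∀ i ∈ B t, ω i = p i)).card < T.card)).card : ℝ) ≤
      2 ^ Fintype.card I * (1 - 1 / 4 ^ (K + 1)) ^ T.card := by
  set D : ℕ := 2 ^ (K + 1) with hD
  have hD1 : 1 ≤ D := Nat.one_le_two_pow
  have hDpos : (0 : ℝ) < D := by exact_mod_cast hD1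
  set β : ℝ := 1 + 1 / D with hβ
  have hβ1 : 1 ≤ β := by rw [hβ]; linarith [one_div_pos.2 hDpos]
  have hβD : 2 ≤ β ^ D := by
    have := one_add_mul_le_pow (a := 1 / (D : ℝ)) (by linarith [one_div_pos.2 hDpos]) D
    rw [mul_one_div_cancel hDpos.ne'] at this
    linarith
  set f : (I → Bool) → ℝ := fun ω =>
    ∏ t ∈ T, (if ∀ i ∈ B t, ω i = p i then (1 / 2 : ℝ) else 1) with hf
  have hfval : ∀ ω, f ω = (1 / 2) ^ (T.filter (fun t => ∀ i ∈ B t, ω i = p i)).card := by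
    intro ω
    simp only [hf, Finset.prod_ite, Finset.prod_const, one_pow, mul_one]
  have hf0 : ∀ ω, 0 ≤ f ω := fun ω => by rw [hfval]; positivity
  have hpt : ∀ ω, D * (T.filter (fun t => ∀ i ∈ B t, ω i = p i)).card < T.card →
      1 ≤ β ^ T.card * f ω := by
    intro ω h
    rw [hfval]
    set x := (T.filter (fun t => ∀ i ∈ B t, ω i = p i)).card
    have h1 : (2 : ℝ) ^ x ≤ β ^ T.card := by
      calc (2 : ℝ) ^ x ≤ (β ^ D) ^ x := pow_le_pow_left₀ (by norm_num) hβD x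
        _ = β ^ (D * x) := by rw [pow_mul]
        _ ≤ _ := pow_le_pow_right₀ hβ1 h.le
    rw [one_div, inv_pow, ← div_eq_mul_inv, le_div_iff₀ (by positivity)]
    linarith
  calc (((Finset.univ : Finset (I → Bool)).filter (fun ω =>
      D * (T.filter (fun t => ∀ i ∈ B t, ω i = p i)).card < T.card)).card : ℝ)
      = ∑ ω ∈ (Finset.univ : Finset (I → Bool)).filter (fun ω =>
        D * (T.filter (fun t => ∀ i ∈ B t, ω i = p i)).card < T.card), (1 : ℝ) := by simp
    _ ≤ ∑ ω ∈ (Finset.univ : Finset (I → Bool)).filter (fun ω =>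
        D * (T.filter (fun t => ∀ i ∈ B t, ω i = p i)).card < T.card), β ^ T.card * f ω :=
        Finset.sum_le_sum fun ω hω => hpt ω (Finset.mem_filter.1 hω).2
    _ ≤ ∑ ω, β ^ T.card * f ω := Finset.sum_le_sum_of_subset_of_nonneg (Finset.filter_subset _ _)
        fun ω _ _ => mul_nonneg (by positivity) (hf0 ω)
    _ = β ^ T.card * ∑ ω, f ω := by rw [Finset.mul_sum]
    _ ≤ β ^ T.card * (2 ^ Fintype.card I * (1 - 1 / 2 ^ (K + 1)) ^ T.card) :=
        mul_le_mul_of_nonneg_left (sum_prod_blocks_le p K B T hK hd) (by positivity)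
    _ = 2 ^ Fintype.card I * (β * (1 - 1 / 2 ^ (K + 1))) ^ T.card := by rw [mul_pow]; ring
    _ = _ := by
        congr 2
        have h4 : (4 : ℝ) ^ (K + 1) = D * D := by
          rw [hD]; push_cast; rw [← mul_pow]; norm_num
        have h2 : (2 : ℝ) ^ (K + 1) = D := by rw [hD]; push_cast; rfl
        rw [hβ, h4, h2]
        field_simp
        ring

end Blocks

section Orders

theorem isAcyclicRel_of_rank {V : Type*} {r : V → V → Prop} (π : V → ℕ)
    (h : ∀ u v, r u v → π u < π v) : IsAcyclicRel r := by
  have key : ∀ u v, Relation.TransGen r u v → π u < π v := by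
    intro u v huv
    induction huv with
    | single h' => exact h _ _ h'
    | tail _ h' ih => exact ih.trans (h _ _ h')
  exact fun v hv => lt_irrefl _ (key v v hv)

open Classical in
/-- An acyclic relation on `Fin n` has a linear extension. -/
theorem exists_rank_of_isAcyclicRel {n : ℕ} {r : Fin n → Fin n → Prop} (hr : IsAcyclicRel r) :
    ∃ π : Fin n → Fin (n * n), Function.Injective π ∧ ∀ u v, r u v → π u < π v := by
  set anc : Fin n → Finset (Fin n) := fun u =>
    Finset.univ.filter (fun w => Relation.TransGen r w u) with hanc
  have hlt : ∀ u, (anc u).card < n := by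
    intro u
    have : anc u ⊂ Finset.univ := by
      refine Finset.ssubset_univ_iff.2 fun h => hr u ?_
      have := h ▸ Finset.mem_univ u
      exact (Finset.mem_filter.1 this).2
    simpa using Finset.card_lt_card this
  have hmono : ∀ u v, r u v → (anc u).card < (anc v).card := by
    intro u v huv
    refine Finset.card_lt_card (Finset.ssubset_iff_of_subset ?_ |>.2 ⟨u, ?_, ?_⟩)
    · intro w hw
      exact Finset.mem_filter.2 ⟨Finset.mem_univ _, (Finset.mem_filter.1 hw).2.tail huv⟩
    · exact Finset.mem_filter.2 ⟨Finset.mem_univ _, Relation.TransGen.single huv⟩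
    · exact fun h => hr u (Finset.mem_filter.1 h).2
  refine ⟨fun u => ⟨n * (anc u).card + u, ?_⟩, ?_, ?_⟩
  · have h1 := hlt u
    have h2 := u.2
    nlinarith
  · intro u v h
    simp only [Fin.mk.injEq] at h
    have h' := congrArg (· % n) h
    simp only [Nat.mul_add_mod, Nat.mod_eq_of_lt u.2, Nat.mod_eq_of_lt v.2] at h'
    exact Fin.ext h'
  · intro u v h
    have h1 := hmono u v h
    have h2 := u.2
    simp only [Fin.mk_lt_mk]
    nlinarith

/-- A minimal feedback arc set consists of the backward arcs of some linear order. -/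
theorem IsMinFAS.exists_rank {n : ℕ} {E F : Fin n → Fin n → Prop} (h : IsMinFAS E F) :
    ∃ π : Fin n → Fin (n * n), Function.Injective π ∧ ∀ u v, F u v ↔ E u v ∧ π v ≤ π u := by
  obtain ⟨⟨hFE, hac⟩, hmin⟩ := h
  obtain ⟨π, hπ, hlt⟩ := exists_rank_of_isAcyclicRel hac
  refine ⟨π, hπ, ?_⟩
  by_contra hne
  refine hmin (fun u v => E u v ∧ π v ≤ π u) ?_ ?_ ⟨fun u v h => h.1, ?_⟩
  · intro u v huv
    by_contra hF
    exact absurd (hlt u v ⟨huv.1, hF⟩) (not_lt.2 huv.2)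
  · intro e
    exact hne fun u v => by rw [← e]
  · refine isAcyclicRel_of_rank (fun u => (π u : ℕ)) fun u v huv => ?_
    by_contra hle
    exact huv.2 ⟨huv.1, not_lt.1 hle⟩

theorem IsFAS.exists_isMinFAS {V : Type*} [Finite V] {E F : V → V → Prop} (h : IsFAS E F) :
    ∃ F', IsMinFAS E F' ∧ ∀ u v, F' u v → F u v := by
  obtain ⟨F', hle, hmin⟩ := (Set.toFinite {F : V → V → Prop | IsFAS E F}).exists_le_minimal h
  refine ⟨F', ⟨hmin.prop, fun F'' hsub hne hF'' => hne ?_⟩, hle⟩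
  exact le_antisymm hsub (hmin.le_of_le hF'' hsub)

end Orders

section Vertices

variable {k n : ℕ}

/-- The `a`-th vertex of residue class `i`. -/
def vtx (i : Fin k) (a : Fin (n / k)) : Fin n :=
  ⟨i + k * a, by
    have h1 := i.2
    have h2 : k * (a + 1) ≤ k * (n / k) := Nat.mul_le_mul_left _ a.2
    have h3 := Nat.mul_div_le n k
    rw [Nat.mul_add] at h2
    omega⟩

theorem vtx_mod (i : Fin k) (a : Fin (n / k)) : (vtx i a : ℕ) % k = i := by
  simp [vtx, Nat.mod_eq_of_lt i.2]

theorem vtx_div (i : Fin k) (a : Fin (n / k)) : (vtx i a : ℕ) / k = a := by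
  have hk : 0 < k := i.pos
  simp [vtx, Nat.add_mul_div_left _ _ hk, Nat.div_eq_of_lt i.2]

theorem vtx_injective {i j : Fin k} {a b : Fin (n / k)} (h : vtx i a = vtx j b) :
    i = j ∧ a = b :=
  ⟨Fin.ext (by rw [← vtx_mod i a, h, vtx_mod]), Fin.ext (by rw [← vtx_div i a, h, vtx_div])⟩

/-- The edge `uv` points backward with respect to the ranking `π`. -/
def BackAdj (π : Fin n → ℕ) (ω : Fin n → Fin n → Bool) (u v : Fin n) : Prop :=
  ω (min u v) (max u v) = decide (π (max u v) < π (min u v))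

theorem BackAdj.symm {π : Fin n → ℕ} {ω : Fin n → Fin n → Bool} {u v : Fin n}
    (h : BackAdj π ω u v) : BackAdj π ω v u := by
  rw [BackAdj, min_comm, max_comm]
  exact h

theorem backAdj_congr {π π' : Fin n → ℕ} (ω : Fin n → Fin n → Bool) {u v : Fin n}
    (h1 : π u < π v ↔ π' u < π' v) (h2 : π v < π u ↔ π' v < π' u) :
    BackAdj π ω u v ↔ BackAdj π' ω u v := by
  rcases le_total u v with h | h
  · simp only [BackAdj, min_eq_left h, max_eq_right h, h2]
  · simp only [BackAdj, min_eq_right h, max_eq_left h, h1]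

theorem BackAdj.turanEdge {π : Fin n → ℕ} {ω : Fin n → Fin n → Bool} {u v : Fin n}
    (hmod : (u : ℕ) % k ≠ (v : ℕ) % k) (h : BackAdj π ω u v) :
    (turanEdge k ω u v ∧ π v ≤ π u) ∨ (turanEdge k ω v u ∧ π u ≤ π v) := by
  have key : ∀ u v : Fin n, (u : ℕ) % k ≠ (v : ℕ) % k → u < v → BackAdj π ω u v →
      (_root_.turanEdge k ω u v ∧ π v ≤ π u) ∨ (_root_.turanEdge k ω v u ∧ π u ≤ π v) := by
    intro u v hmod huv h
    have huv' : (u : ℕ) < v := huv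
    rw [BackAdj, min_eq_left huv.le, max_eq_right huv.le] at h
    by_cases hlt : π v < π u
    · left
      exact ⟨⟨hmod, by rw [if_pos huv', h]; simpa using hlt⟩, hlt.le⟩
    · right
      exact ⟨⟨hmod.symm, by rw [if_neg (by omega), h]; simpa using hlt⟩, not_lt.1 hlt⟩
  rcases lt_trichotomy u v with huv | huv | huv
  · exact key u v hmod huv h
  · exact absurd (by rw [huv]) hmod
  · exact (key v u hmod.symm huv h.symm).symm

/-- Backward adjacency of the Turán graph in coordinates `(part, index)`. -/
def partAdj (k : ℕ) (π : Fin n → ℕ) (ω : Fin n → Fin n → Bool) :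
    Fin k → Fin (n / k) → Fin k → Fin (n / k) → Prop :=
  fun i a j b => BackAdj π ω (vtx i a) (vtx j b)

open Classical in
theorem isTransClique_image {E F : Fin n → Fin n → Prop} {π : Fin n → ℕ}
    {ω : Fin n → Fin n → Bool} (hπ : Function.Injective π) (hE : E = turanEdge k ω)
    (hF : ∀ u v, F u v ↔ E u v ∧ π v ≤ π u) {q : Fin k → Fin (n / k)}
    (hq : CliqueOn (partAdj k π ω) Finset.univ q) :
    IsTransClique F k (Finset.univ.image (fun i => vtx i (q i))) := by
  subst hE
  refine ⟨?_, ?_, ?_⟩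
  · rw [Finset.card_image_of_injective, Finset.card_univ, Fintype.card_fin]
    exact fun i j h => (vtx_injective h).1
  · intro u hu v hv huv
    obtain ⟨i, -, rfl⟩ := Finset.mem_image.1 hu
    obtain ⟨j, -, rfl⟩ := Finset.mem_image.1 hv
    have hij : i ≠ j := by rintro rfl; exact huv rfl
    rw [hF, hF]
    refine BackAdj.turanEdge ?_ (hq i (Finset.mem_univ _) j (Finset.mem_univ _) hij)
    rw [vtx_mod, vtx_mod]
    exact fun h => hij (Fin.ext h)
  · -- the reversed relation increases `π`
    have key : ∀ u v, Relation.TransGen (fun a b => a ∈ Finset.univ.image (fun i => vtx i (q i)) ∧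
        b ∈ Finset.univ.image (fun i => vtx i (q i)) ∧ F a b) u v → π v < π u := by
      intro u v h
      have step : ∀ a b, F a b → π b < π a := by
        intro a b hab
        obtain ⟨⟨h1, -⟩, h2⟩ := (hF a b).1 hab
        refine lt_of_le_of_ne h2 fun e => h1 ?_
        rw [hπ e]
      induction h with
      | single h' => exact step _ _ h'.2.2
      | tail _ h' ih => exact (step _ _ h'.2.2).trans ih
    exact fun v hv => lt_irrefl _ (key v v hv)

open Classical in
/-- Common backward neighbours, in part `i`, of `v` placed first and `v'` placed last. -/
noncomputable def commonDegree (k : ℕ) (ω : Fin n → Fin n → Bool) (v v' : Fin n) (i : Fin k) : ℕ :=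
  (Finset.univ.filter (fun a : Fin (n / k) =>
    BackAdj (fun x => if x = v then 0 else if x = v' then 2 else 1) ω v (vtx i a) ∧
    BackAdj (fun x => if x = v then 0 else if x = v' then 2 else 1) ω v' (vtx i a))).card

open Classical in
theorem commonDegree_le {π : Fin n → ℕ} {ω : Fin n → Fin n → Bool} {i j j' : Fin k}
    {a a' : Fin (n / k)} (hj : j ≠ i) (hj' : j' ≠ i) (hlt : π (vtx j a) < π (vtx j' a')) :
    commonDegree k ω (vtx j a) (vtx j' a') i ≤
      partDegree (partAdj k π ω) j a i + partDegree (partAdj k π ω) j' a' i := by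
  refine (Finset.card_le_card ?_).trans (Finset.card_union_le _ _)
  intro b hb
  obtain ⟨h1, h2⟩ := (Finset.mem_filter.1 hb).2
  have hne : vtx j' a' ≠ vtx j a := fun h => by rw [h] at hlt; exact lt_irrefl _ hlt
  have hb1 : vtx i b ≠ vtx j a := fun h => hj (vtx_injective h).1.symm
  have hb2 : vtx i b ≠ vtx j' a' := fun h => hj' (vtx_injective h).1.symm
  by_cases hπ : π (vtx j a) < π (vtx i b)
  · refine Finset.mem_union_left _ (Finset.mem_filter.2 ⟨Finset.mem_univ _, ?_⟩)
    refine (backAdj_congr ω ?_ ?_).1 h1 <;> simp [hb1, hb2, hπ, hπ.le]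
  · refine Finset.mem_union_right _ (Finset.mem_filter.2 ⟨Finset.mem_univ _, ?_⟩)
    have hπ' : π (vtx i b) < π (vtx j' a') := (not_lt.1 hπ).trans_lt hlt
    refine (backAdj_congr ω ?_ ?_).1 h2 <;> simp [hne, hb1, hb2, hπ', hπ'.le]

open Classical in
theorem exists_trans_cliques (hk : 2 ≤ k) {ω : Fin n → Fin n → Bool} {s : ℕ} (hs : 0 < s)
    (hn : 160 * (2 ^ k * k ^ 2 * s) ≤ n / k)
    (hB : ∀ π : Fin n → Fin (n * n), JoinDense (partAdj k (fun x => (π x : ℕ)) ω) s (2 ^ k))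
    (hP : ∀ (v v' : Fin n) (i : Fin k), v ≠ v' → (v : ℕ) % k ≠ i → (v' : ℕ) % k ≠ i →
      n / k ≤ 8 * commonDegree k ω v v' i)
    {F : Fin n → Fin n → Prop} (hF : IsMinFAS (turanEdge k ω) F) :
    ∃ C : Finset (Finset (Fin n)), C.card = n / k + 1 - k ∧
      (∀ S ∈ C, IsTransClique F k S) ∧
      (∀ S ∈ C, ∀ S' ∈ C, S ≠ S' → Disjoint S S') := by
  obtain ⟨π, hπ, hFπ⟩ := hF.exists_rank
  have hπ' : Function.Injective (fun x => (π x : ℕ)) := Fin.val_injective.comp hπ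
  have hpos : 0 < 2 ^ k * k ^ 2 * s := by positivity
  obtain ⟨Q, hQ, hQc, hQP⟩ := exists_disjoint_cliques (R := partAdj k (fun x => (π x : ℕ)) ω) hk
    (fun _ _ _ _ h => h.symm) hs (D := 2 ^ k) (by positivity)
    (d := 10 * (2 ^ k * k ^ 2 * s)) le_rfl (by omega) (hB π) (by
      have key : ∀ (i j j' : Fin k) (a a' : Fin (n / k)), j ≠ i → j' ≠ i →
          (π (vtx j a) : ℕ) < π (vtx j' a') →
          10 * (2 ^ k * k ^ 2 * s) ≤ partDegree (partAdj k (fun x => (π x : ℕ)) ω) j a i ∨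
          10 * (2 ^ k * k ^ 2 * s) ≤ partDegree (partAdj k (fun x => (π x : ℕ)) ω) j' a' i := by
        intro i j j' a a' hj hj' hlt
        have h1 := commonDegree_le (π := fun x => (π x : ℕ)) (ω := ω) hj hj' hlt
        have h2 := hP (vtx j a) (vtx j' a') i (fun h => by rw [h] at hlt; exact lt_irrefl _ hlt)
          (by rw [vtx_mod]; exact fun h => hj (Fin.ext h))
          (by rw [vtx_mod]; exact fun h => hj' (Fin.ext h))
        omega
      intro i j j' a a' hj hj' hne
      rcases lt_trichotomy (π (vtx j a) : ℕ) (π (vtx j' a')) with h | h | h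
      · exact key i j j' a a' hj hj' h
      · obtain ⟨rfl, rfl⟩ := vtx_injective (hπ' h)
        exact absurd rfl hne
      · exact (key i j' j a' a hj' hj h).symm)
  have hdis : ∀ q ∈ Q, ∀ q' ∈ Q, q ≠ q' → Disjoint (Finset.univ.image (fun i => vtx i (q i)))
      (Finset.univ.image (fun i => vtx i (q' i))) := by
    intro q hq q' hq' hne
    refine Finset.disjoint_left.2 fun x hx hx' => ?_
    obtain ⟨i, -, rfl⟩ := Finset.mem_image.1 hx
    obtain ⟨j, -, h⟩ := Finset.mem_image.1 hx'
    obtain ⟨rfl, h⟩ := vtx_injective h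
    exact hQ q hq q' hq' hne _ h.symm
  refine ⟨Q.image (fun q => Finset.univ.image (fun i => vtx i (q i))), ?_, ?_, ?_⟩
  · rw [Finset.card_image_of_injOn, hQc]
    intro q hq q' hq' e
    by_contra hne
    have h1 := hdis q hq q' hq' hne
    simp only at e
    rw [← e, Finset.disjoint_self_iff_empty] at h1
    have h2 : vtx ⟨0, by omega⟩ (q ⟨0, by omega⟩) ∈ (∅ : Finset (Fin n)) :=
      h1 ▸ Finset.mem_image_of_mem (fun i => vtx i (q i)) (Finset.mem_univ _)
    simp at h2
  · intro S hS
    obtain ⟨q, hq, rfl⟩ := Finset.mem_image.1 hS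
    exact isTransClique_image hπ' rfl hFπ (hQP q hq)
  · intro S hS S' hS' hne
    obtain ⟨q, hq, rfl⟩ := Finset.mem_image.1 hS
    obtain ⟨q', hq', rfl⟩ := Finset.mem_image.1 hS'
    exact hdis q hq q' hq' fun h => hne (by rw [h])

theorem IsTransClique.exists_mem_mod {ω : Fin n → Fin n → Bool} {F : Fin n → Fin n → Prop}
    (hF : ∀ u v, F u v → turanEdge k ω u v) {S : Finset (Fin n)} (hS : IsTransClique F k S)
    {j : ℕ} (hj : j < k) : ∃ x ∈ S, (x : ℕ) % k = j := by
  have himg : S.image (fun x : Fin n => (x : ℕ) % k) = Finset.range k := by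
    refine Finset.eq_of_subset_of_card_le ?_ ?_
    · intro y hy
      obtain ⟨x, -, rfl⟩ := Finset.mem_image.1 hy
      exact Finset.mem_range.2 (Nat.mod_lt _ (by omega))
    · rw [Finset.card_image_of_injOn, hS.1, Finset.card_range]
      intro x hx y hy hxy
      by_contra hne
      rcases hS.2.1 x hx y hy hne with h | h
      · exact (hF _ _ h).1 hxy
      · exact (hF _ _ h).1 hxy.symm
  have := himg ▸ Finset.mem_range.2 hj
  exact Finset.mem_image.1 this

theorem not_turanEdge_of_turanEdge {ω : Fin n → Fin n → Bool} {u v : Fin n}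
    (h : turanEdge k ω u v) : ¬ turanEdge k ω v u := by
  rintro ⟨-, h'⟩
  obtain ⟨hne, h⟩ := h
  rcases lt_trichotomy (u : ℕ) v with huv | huv | huv
  · rw [if_pos huv] at h
    rw [if_neg (by omega)] at h'
    simp [h] at h'
  · exact hne (by rw [huv])
  · rw [if_neg (by omega)] at h
    rw [if_pos huv] at h'
    simp [h] at h'

open Classical in
/-- Some minimal feedback arc set isolates `k - 1` vertices of the smallest part. -/
theorem exists_isMinFAS_few_cliques (hk : 2 ≤ k) (hn : k ≤ n / k) (ω : Fin n → Fin n → Bool) :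
    ∃ F : Fin n → Fin n → Prop, IsMinFAS (turanEdge k ω) F ∧
      ∀ C : Finset (Finset (Fin n)), (∀ S ∈ C, IsTransClique F k S) →
        (∀ S ∈ C, ∀ S' ∈ C, S ≠ S' → Disjoint S S') → C.card ≤ n / k + 1 - k := by
  set z : ℕ → Fin n := fun j =>
    if h : j < k then vtx ⟨k - 1, by omega⟩ ⟨j, h.trans_le hn⟩ else
      ⟨0, by have := Nat.div_le_self n k; omega⟩ with hz
  have hzmod : ∀ j, j < k → (z j : ℕ) % k = k - 1 := by
    intro j hj
    simp only [hz, hj, dif_pos]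
    exact vtx_mod _ _
  set π : Fin n → ℕ := fun x =>
    if (x : ℕ) % k = k - 1 then 1 else if turanEdge k ω x (z ((x : ℕ) % k)) then 0 else 2 with hπ
  obtain ⟨F, hF, hFle⟩ := IsFAS.exists_isMinFAS
    (E := turanEdge k ω) (F := fun u v => turanEdge k ω u v ∧ ¬ π u < π v)
    ⟨fun u v h => h.1, isAcyclicRel_of_rank π fun u v h => by
      by_contra hlt
      exact h.2 ⟨h.1, hlt⟩⟩
  refine ⟨F, hF, fun C hC hd => ?_⟩
  have hFE : ∀ u v, F u v → turanEdge k ω u v := fun u v h => (hFle u v h).1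
  have hzS : ∀ S ∈ C, ∀ j, j < k - 1 → z j ∉ S := by
    intro S hS j hj hzj
    obtain ⟨x, hx, hxj⟩ := (hC S hS).exists_mem_mod hFE (show j < k by omega)
    have hzj' := hzmod j (by omega)
    have hne : x ≠ z j := fun h => by rw [h] at hxj; omega
    have hπz : π (z j) = 1 := by simp [hπ, hzj']
    have hx1 : (x : ℕ) % k ≠ k - 1 := by omega
    rcases (hC S hS).2.1 x hx (z j) hzj hne with h | h
    · obtain ⟨h1, h2⟩ := hFle _ _ h
      have : π x = 0 := by
        simp only [hπ]
        rw [if_neg hx1, hxj, if_pos h1]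
      omega
    · obtain ⟨h1, h2⟩ := hFle _ _ h
      have : π x = 2 := by
        simp only [hπ]
        rw [if_neg hx1, hxj, if_neg (not_turanEdge_of_turanEdge h1)]
      omega
  have hex : ∀ S ∈ C, ∃ x ∈ S, (x : ℕ) % k = k - 1 := fun S hS =>
    (hC S hS).exists_mem_mod hFE (by omega)
  have : Nonempty (Fin n) := ⟨z 0⟩
  choose! c hcS hcm using hex
  have hdecomp : ∀ x : Fin n, (x : ℕ) % k = k - 1 → (x : ℕ) = k - 1 + k * ((x : ℕ) / k) :=
    fun x hx => by have := Nat.mod_add_div (x : ℕ) k; omega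
  have hle : C.card ≤ (Finset.Ico (k - 1) (n / k)).card := by
    refine Finset.card_le_card_of_injOn (fun S => (c S : ℕ) / k) ?_ ?_
    · intro S hS
      have h1 := hdecomp _ (hcm S hS)
      refine Finset.mem_coe.2 (Finset.mem_Ico.2 ⟨?_, ?_⟩)
      · by_contra hlt
        have hlt' : (c S : ℕ) / k < k - 1 := not_le.1 hlt
        refine hzS S hS ((c S : ℕ) / k) hlt' ?_
        have : z ((c S : ℕ) / k) = c S := by
          refine Fin.ext ?_
          simp only [hz]
          rw [dif_pos (show (c S : ℕ) / k < k by omega)]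
          exact h1.symm
        rw [this]
        exact hcS S hS
      · rw [← Nat.add_one_le_iff, Nat.le_div_iff_mul_le (by omega), Nat.add_mul, mul_comm]
        have := (c S).2
        simp only
        omega
    · intro S hS S' hS' e
      by_contra hne
      have h1 := hdecomp _ (hcm S hS)
      have h2 := hdecomp _ (hcm S' hS')
      simp only at e
      rw [e, ← h2] at h1
      have h3 : c S = c S' := Fin.ext h1
      exact Finset.disjoint_left.1 (hd S hS S' hS' hne) (hcS S hS) (h3 ▸ hcS S' hS')
  rw [Nat.card_Ico] at hle
  omega

end Vertices

section Probability

variable {k n : ℕ}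

theorem card_le_card_mul_of_forall_exists {Ω ι : Type*} [Fintype ι] (A : Finset Ω)
    (B : ι → Finset Ω) (b : ℝ) (hA : ∀ ω ∈ A, ∃ i, ω ∈ B i) (hB : ∀ i, ((B i).card : ℝ) ≤ b) :
    (A.card : ℝ) ≤ Fintype.card ι * b := by
  classical
  have h1 : A ⊆ Finset.univ.biUnion B := fun ω hω => by simpa using hA ω hω
  calc (A.card : ℝ) ≤ ((∑ i, (B i).card : ℕ) : ℝ) := by
        exact_mod_cast (Finset.card_le_card h1).trans Finset.card_biUnion_le
    _ = ∑ i, ((B i).card : ℝ) := by push_cast; rfl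
    _ ≤ ∑ _i : ι, b := Finset.sum_le_sum fun i _ => hB i
    _ = Fintype.card ι * b := by simp

/-- The coordinate of the orientation data that decides the pair `u`, `v`. -/
def edgeOf (u v : Fin n) : Fin n × Fin n := (min u v, max u v)

theorem edgeOf_eq {u v u' v' : Fin n} (h : edgeOf u v = edgeOf u' v') :
    (u = u' ∧ v = v') ∨ (u = v' ∧ v = u') := by
  rw [edgeOf, edgeOf, Prod.mk.injEq] at h
  obtain ⟨h1, h2⟩ := h
  rcases le_total u v with h | h <;> rcases le_total u' v' with h' | h' <;>
    simp only [h, h', min_eq_left, min_eq_right, max_eq_left, max_eq_right] at h1 h2 <;> tauto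

open Classical in
theorem card_few_agree_le (π : Fin n → ℕ) (K : ℕ) {ι : Type*} (B : ι → Finset (Fin n × Fin n))
    (T : Finset ι) (hK : ∀ t ∈ T, (B t).card ≤ K)
    (hd : ∀ t ∈ T, ∀ t' ∈ T, t ≠ t' → Disjoint (B t) (B t')) :
    (((Finset.univ : Finset (Fin n → Fin n → Bool)).filter (fun ω =>
      2 ^ (K + 1) * (T.filter (fun t => ∀ x ∈ B t,
        ω x.1 x.2 = decide (π x.2 < π x.1))).card < T.card)).card : ℝ) ≤
      2 ^ (n * n) * (1 - 1 / 4 ^ (K + 1)) ^ T.card := by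
  have h := card_few_blocks_le (fun x : Fin n × Fin n => decide (π x.2 < π x.1)) K B T hK hd
  rw [Fintype.card_prod, Fintype.card_fin] at h
  refine (Nat.cast_le.2 ?_).trans h
  refine Finset.card_le_card_of_injOn (fun ω x => ω x.1 x.2) ?_ ?_
  · intro ω hω
    refine Finset.mem_coe.2 (Finset.mem_filter.2 ⟨Finset.mem_univ _, ?_⟩)
    convert (Finset.mem_filter.1 hω).2
  · intro ω _ ω' _ e
    funext a b
    exact congrFun e (a, b)

open Classical in
theorem card_few_joins_le (π : Fin n → ℕ) (i : Fin k) (f : Fin (n / k) → Fin k → Fin (n / k))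
    (T W : Finset (Fin (n / k))) (hf : ∀ j, Set.InjOn (fun t => f t j) T) :
    (((Finset.univ : Finset (Fin n → Fin n → Bool)).filter (fun ω =>
      2 ^ k * ((T ×ˢ W).filter (fun p => Joins (partAdj k π ω) i p.2 (f p.1))).card <
        T.card * W.card)).card : ℝ) ≤
      2 ^ (n * n) * (1 - 1 / 4 ^ k) ^ (T.card * W.card) := by
  have hk : k - 1 + 1 = k := by have := i.pos; omega
  have h := card_few_agree_le π (k - 1) (fun p : Fin (n / k) × Fin (n / k) =>
    (Finset.univ.erase i).image (fun j => edgeOf (vtx i p.2) (vtx j (f p.1 j)))) (T ×ˢ W) ?_ ?_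
  · rw [hk, Finset.card_product] at h
    convert h using 10
    rename_i p
    simp only [Finset.mem_image, Finset.mem_erase, Finset.mem_univ, and_true, Joins, partAdj,
      BackAdj, edgeOf, forall_exists_index, and_imp, forall_apply_eq_imp_iff₂]
  · intro p _
    refine Finset.card_image_le.trans ?_
    rw [Finset.card_erase_of_mem (Finset.mem_univ _), Finset.card_univ, Fintype.card_fin]
  · intro p hp p' hp' hne
    refine Finset.disjoint_left.2 fun x hx hx' => hne ?_
    obtain ⟨j, hj, rfl⟩ := Finset.mem_image.1 hx
    obtain ⟨j', hj', e⟩ := Finset.mem_image.1 hx'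
    rcases edgeOf_eq e with ⟨e1, e2⟩ | ⟨e1, -⟩
    · obtain ⟨-, e1⟩ := vtx_injective e1
      obtain ⟨rfl, e2⟩ := vtx_injective e2
      exact Prod.ext (hf j' (Finset.mem_product.1 hp).1 (Finset.mem_product.1 hp').1 e2.symm)
        e1.symm
    · exact absurd (vtx_injective e1).1.symm (Finset.mem_erase.1 hj).1

open Classical in
theorem exists_few_joins {M s D : ℕ} {R : Fin k → Fin M → Fin k → Fin M → Prop}
    (h : ¬ JoinDense R s D) : ∃ (i : Fin k) (f : Fin M → Fin k → Fin M) (T W : Finset (Fin M)),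
      (∀ j, Set.InjOn (fun t => f t j) T) ∧ s ≤ T.card ∧ s ≤ W.card ∧
      D * ((T ×ˢ W).filter (fun p => Joins R i p.2 (f p.1))).card < T.card * W.card := by
  simp only [JoinDense, not_forall, not_le] at h
  obtain ⟨i, Q, W, hQ, hs, hW, hlt⟩ := h
  have hex : ∀ a ∈ Q.image (fun q => q i), ∃ q ∈ Q, q i = a := fun a ha => Finset.mem_image.1 ha
  choose! f hfQ hfi using hex
  have hT : (Q.image (fun q => q i)).card = Q.card := hQ.card_image i
  refine ⟨i, f, Q.image (fun q => q i), W, ?_, by omega, hW, ?_⟩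
  · intro j a ha b hb e
    by_contra hne
    refine hQ _ (hfQ a ha) _ (hfQ b hb) (fun e' => hne ?_) j e
    rw [← hfi a ha, e', hfi b hb]
  · rw [hT]
    refine lt_of_le_of_lt (Nat.mul_le_mul_left _ ?_) hlt
    refine Finset.card_le_card_of_injOn (fun p => (f p.1, p.2)) ?_ ?_
    · intro p hp
      obtain ⟨h1, h2⟩ := Finset.mem_filter.1 hp
      obtain ⟨h3, h4⟩ := Finset.mem_product.1 h1
      exact Finset.mem_coe.2 (Finset.mem_filter.2 ⟨Finset.mem_product.2 ⟨hfQ _ h3, h4⟩, h2⟩)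
    · intro p hp p' hp' e
      have h3 := (Finset.mem_product.1 (Finset.mem_filter.1 hp).1).1
      have h3' := (Finset.mem_product.1 (Finset.mem_filter.1 hp').1).1
      obtain ⟨e1, e2⟩ := Prod.mk.inj e
      refine Prod.ext ?_ e2
      rw [← hfi _ h3, e1, hfi _ h3']

open Classical in
theorem card_not_joinDense_le (hn : 2 ≤ n) (hk : k ≤ n) (s : ℕ) :
    (((Finset.univ : Finset (Fin n → Fin n → Bool)).filter (fun ω =>
      ∃ π : Fin n → Fin (n * n),
        ¬ JoinDense (partAdj k (fun x => (π x : ℕ)) ω) s (2 ^ k))).card : ℝ) ≤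
      n ^ (6 * n) * (2 ^ (n * n) * (1 - 1 / 4 ^ k) ^ (s * s)) := by
  have hρ0 : (0 : ℝ) ≤ 1 - 1 / 4 ^ k := by
    rw [sub_nonneg, div_le_one (by positivity)]
    exact one_le_pow₀ (by norm_num)
  have hρ1 : (1 : ℝ) - 1 / 4 ^ k ≤ 1 := by
    have : (0 : ℝ) < 1 / 4 ^ k := by positivity
    linarith
  have hb : (0 : ℝ) ≤ 2 ^ (n * n) * (1 - 1 / 4 ^ k) ^ (s * s) := by positivity
  refine (card_le_card_mul_of_forall_exists
    (ι := (Fin n → Fin (n * n)) × Fin k × (Fin (n / k) → Fin k → Fin (n / k)) ×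
      Finset (Fin (n / k)) × Finset (Fin (n / k))) _
    (fun x => Finset.univ.filter fun ω => ((∀ j, Set.InjOn (fun t => x.2.2.1 t j) x.2.2.2.1) ∧
      s ≤ x.2.2.2.1.card ∧ s ≤ x.2.2.2.2.card) ∧
      2 ^ k * ((x.2.2.2.1 ×ˢ x.2.2.2.2).filter (fun p =>
        Joins (partAdj k (fun y => (x.1 y : ℕ)) ω) x.2.1 p.2 (x.2.2.1 p.1))).card <
        x.2.2.2.1.card * x.2.2.2.2.card)
    (2 ^ (n * n) * (1 - 1 / 4 ^ k) ^ (s * s)) ?_ ?_).trans (mul_le_mul_of_nonneg_right ?_ hb)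
  · intro ω hω
    obtain ⟨π, hπ⟩ := (Finset.mem_filter.1 hω).2
    obtain ⟨i, f, T, W, h1, h2, h3, h4⟩ := exists_few_joins hπ
    exact ⟨(π, i, f, T, W), Finset.mem_filter.2 ⟨Finset.mem_univ _, ⟨h1, h2, h3⟩, h4⟩⟩
  · rintro ⟨π, i, f, T, W⟩
    by_cases h : (∀ j, Set.InjOn (fun t => f t j) T) ∧ s ≤ T.card ∧ s ≤ W.card
    · obtain ⟨h1, h2, h3⟩ := h
      have h4 := card_few_joins_le (fun y => (π y : ℕ)) i f T W h1
      have h5 : (1 - 1 / 4 ^ k : ℝ) ^ (T.card * W.card) ≤ (1 - 1 / 4 ^ k) ^ (s * s) :=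
        pow_le_pow_of_le_one hρ0 hρ1 (Nat.mul_le_mul h2 h3)
      refine (Nat.cast_le.2 (Finset.card_le_card fun ω hω => ?_)).trans
        (h4.trans (mul_le_mul_of_nonneg_left h5 (by positivity)))
      exact Finset.mem_filter.2 ⟨Finset.mem_univ _, (Finset.mem_filter.1 hω).2.2⟩
    · refine (Nat.cast_le.2 (Finset.card_le_card (t := ∅) fun ω hω =>
        absurd (Finset.mem_filter.1 hω).2.1 h)).trans ?_
      simpa using hb
  · have hM : n / k ≤ n := Nat.div_le_self n k
    have hMk : k * (n / k) ≤ n := Nat.mul_div_le n k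
    have hfin : (n * n) ^ n * (k * (((n / k) ^ k) ^ (n / k) * (2 ^ (n / k) * 2 ^ (n / k)))) ≤
        n ^ (6 * n) := by
      have e : n ^ (6 * n) = (n * n) ^ n * (n ^ n * (n ^ n * (n ^ n * n ^ n))) := by ring
      have h1 : k ≤ n ^ n := hk.trans (Nat.le_self_pow (by omega) n)
      have h2 : ((n / k) ^ k) ^ (n / k) ≤ n ^ n := by
        rw [← pow_mul]
        exact (Nat.pow_le_pow_left hM _).trans (Nat.pow_le_pow_right (by omega) hMk)
      have h3 : 2 ^ (n / k) ≤ n ^ n :=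
        (Nat.pow_le_pow_left hn _).trans (Nat.pow_le_pow_right (by omega) hM)
      rw [e]
      gcongr
    have : Fintype.card ((Fin n → Fin (n * n)) × Fin k × (Fin (n / k) → Fin k → Fin (n / k)) ×
        Finset (Fin (n / k)) × Finset (Fin (n / k))) =
        (n * n) ^ n * (k * (((n / k) ^ k) ^ (n / k) * (2 ^ (n / k) * 2 ^ (n / k)))) := by
      simp
    rw [this]
    exact_mod_cast hfin

open Classical in
theorem card_few_commonDegree_le {v v' : Fin n} {i : Fin k} (h2 : (v : ℕ) % k ≠ i)
    (h3 : (v' : ℕ) % k ≠ i) :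
    (((Finset.univ : Finset (Fin n → Fin n → Bool)).filter (fun ω =>
      8 * commonDegree k ω v v' i < n / k)).card : ℝ) ≤ 2 ^ (n * n) * (63 / 64) ^ (n / k) := by
  have h := card_few_agree_le (fun x : Fin n => if x = v then 0 else if x = v' then 2 else 1) 2
    (fun a : Fin (n / k) => {edgeOf v (vtx i a), edgeOf v' (vtx i a)}) Finset.univ
    (fun _ _ => Finset.card_le_two) ?_
  · rw [Finset.card_univ, Fintype.card_fin,
      show (1 - 1 / 4 ^ (2 + 1) : ℝ) = 63 / 64 by norm_num] at h
    refine (Nat.cast_le.2 (Finset.card_le_card fun ω hω => ?_)).trans h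
    refine Finset.mem_filter.2 ⟨Finset.mem_univ _, lt_of_le_of_lt ?_ (Finset.mem_filter.1 hω).2⟩
    refine Nat.mul_le_mul_left 8 (Finset.card_le_card fun a ha => ?_)
    have ha := (Finset.mem_filter.1 ha).2
    exact Finset.mem_filter.2 ⟨Finset.mem_univ _, ha _ (Finset.mem_insert_self _ _),
      ha _ (Finset.mem_insert_of_mem (Finset.mem_singleton_self _))⟩
  · intro a _ b _ hab
    refine Finset.disjoint_left.2 fun x hx hx' => hab ?_
    have key : ∀ y z : Fin n, (y : ℕ) % k ≠ i → edgeOf y (vtx i a) = edgeOf z (vtx i b) →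
        a = b := by
      intro y z hy e
      rcases edgeOf_eq e with ⟨-, e⟩ | ⟨e, -⟩
      · exact (vtx_injective e).2
      · exact absurd (by rw [e, vtx_mod]) hy
    simp only [Finset.mem_insert, Finset.mem_singleton] at hx hx'
    rcases hx with rfl | rfl <;> rcases hx' with e | e
    · exact key _ _ h2 e
    · exact key _ _ h2 e
    · exact key _ _ h3 e
    · exact key _ _ h3 e

open Classical in
theorem card_small_commonDegree_le (hk : k ≤ n) :
    (((Finset.univ : Finset (Fin n → Fin n → Bool)).filter (fun ω =>
      ∃ x : Fin n × Fin n × Fin k, x.1 ≠ x.2.1 ∧ (x.1 : ℕ) % k ≠ x.2.2 ∧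
        (x.2.1 : ℕ) % k ≠ x.2.2 ∧ 8 * commonDegree k ω x.1 x.2.1 x.2.2 < n / k)).card : ℝ) ≤
      n ^ 3 * (2 ^ (n * n) * (63 / 64) ^ (n / k)) := by
  have hb : (0 : ℝ) ≤ 2 ^ (n * n) * (63 / 64) ^ (n / k) := by positivity
  refine (card_le_card_mul_of_forall_exists (ι := Fin n × Fin n × Fin k) _
    (fun x => Finset.univ.filter fun ω => (x.1 ≠ x.2.1 ∧ (x.1 : ℕ) % k ≠ x.2.2 ∧
        (x.2.1 : ℕ) % k ≠ x.2.2) ∧ 8 * commonDegree k ω x.1 x.2.1 x.2.2 < n / k)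
    (2 ^ (n * n) * (63 / 64) ^ (n / k)) ?_ ?_).trans (mul_le_mul_of_nonneg_right ?_ hb)
  · intro ω hω
    obtain ⟨x, h1, h2, h3, h4⟩ := (Finset.mem_filter.1 hω).2
    exact ⟨x, Finset.mem_filter.2 ⟨Finset.mem_univ _, ⟨h1, h2, h3⟩, h4⟩⟩
  · rintro ⟨v, v', i⟩
    by_cases h : v ≠ v' ∧ (v : ℕ) % k ≠ i ∧ (v' : ℕ) % k ≠ i
    · obtain ⟨-, h2, h3⟩ := h
      refine (Nat.cast_le.2 (Finset.card_le_card fun ω hω => ?_)).trans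
        (card_few_commonDegree_le h2 h3)
      exact Finset.mem_filter.2 ⟨Finset.mem_univ _, (Finset.mem_filter.1 hω).2.2⟩
    · refine (Nat.cast_le.2 (Finset.card_le_card (t := ∅) fun ω hω =>
        absurd (Finset.mem_filter.1 hω).2.1 h)).trans ?_
      simpa using hb
  · simp only [Fintype.card_prod, Fintype.card_fin]
    have : n * (n * k) ≤ n ^ 3 := by
      calc n * (n * k) ≤ n * (n * n) := by gcongr
        _ = n ^ 3 := by ring
    exact_mod_cast this

theorem exists_scale (k : ℕ) (hk : 2 ≤ k) {ε : ℝ} (hε : 0 < ε) :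
    ∃ N : ℕ, ∀ n ≥ N, ∃ s : ℕ, 0 < s ∧ 160 * (2 ^ k * k ^ 2 * s) ≤ n / k ∧
      (n : ℝ) ^ (6 * n) * (1 - 1 / 4 ^ k) ^ (s * s) + n ^ 3 * (63 / 64) ^ (n / k) ≤ ε := by
  set c : ℕ := 160 * (2 ^ k * k ^ 2) with hc
  have hc0 : 0 < c := by positivity
  set a : ℕ := 2 * (k * c) with ha
  set ρ : ℝ := 1 - 1 / 4 ^ k with hρ
  have hρ0 : 0 ≤ ρ := by
    rw [hρ, sub_nonneg, div_le_one (by positivity)]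
    exact one_le_pow₀ (by norm_num)
  have hρ1 : ρ < 1 := by
    have : (0 : ℝ) < 1 / 4 ^ k := by positivity
    linarith
  have t1 : Filter.Tendsto (fun s : ℕ => (a : ℝ) ^ (6 * a) * ((s : ℝ) ^ (6 * a) * ρ ^ s))
      Filter.atTop (nhds 0) := by
    simpa using (tendsto_pow_const_mul_const_pow_of_abs_lt_one (6 * a)
      (by rwa [abs_of_nonneg hρ0])).const_mul ((a : ℝ) ^ (6 * a))
  have t2 : Filter.Tendsto (fun s : ℕ => (a : ℝ) ^ 3 * ((s : ℝ) ^ 3 * (63 / 64 : ℝ) ^ s))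
      Filter.atTop (nhds 0) := by
    simpa using (tendsto_pow_const_mul_const_pow_of_abs_lt_one 3
      (show |(63 / 64 : ℝ)| < 1 by norm_num [abs_of_nonneg])).const_mul ((a : ℝ) ^ 3)
  have e1 := t1.eventually_le_const (show (0 : ℝ) < min 1 (ε / 2) by positivity)
  have e2 := t2.eventually_le_const (show (0 : ℝ) < ε / 2 by positivity)
  obtain ⟨S, hS⟩ := Filter.eventually_atTop.1 (e1.and e2)
  refine ⟨k * c * (S + 1), fun n hn => ⟨n / k / c, ?_, ?_, ?_⟩⟩
  · rw [Nat.div_div_eq_div_mul]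
    refine Nat.div_pos (le_trans ?_ hn) (by positivity)
    exact Nat.le_mul_of_pos_right _ (by omega)
  · calc 160 * (2 ^ k * k ^ 2 * (n / k / c)) = c * (n / k / c) := by rw [hc]; ring
      _ ≤ n / k := Nat.mul_div_le _ _
  set s : ℕ := n / k / c with hs
  have hkc : 0 < k * c := by positivity
  have hsS : S + 1 ≤ s := by
    rw [hs, Nat.div_div_eq_div_mul, Nat.le_div_iff_mul_le hkc, mul_comm]
    exact hn
  have hn1 : 1 ≤ n := le_trans (Nat.mul_pos hkc (by omega)) hn
  have hna : n ≤ a * s := by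
    have h1 : n < k * c * (s + 1) := by
      rw [hs, Nat.div_div_eq_div_mul]
      exact Nat.lt_mul_div_succ n hkc
    have h2 : k * c * 1 ≤ k * c * s := Nat.mul_le_mul_left _ (by omega)
    have h3 : a * s = k * c * s + k * c * s := by rw [ha]; ring
    rw [Nat.mul_add] at h1
    omega
  have hMs : s ≤ n / k := Nat.div_le_self _ _
  have hnaR : (n : ℝ) ≤ a * s := by exact_mod_cast hna
  have hn1R : (1 : ℝ) ≤ n := by exact_mod_cast hn1
  obtain ⟨b1, b2⟩ := hS s (by omega)
  have g1 : (n : ℝ) ^ (6 * n) * ρ ^ (s * s) ≤ ε / 2 := by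
    have hx0 : 0 ≤ (a : ℝ) ^ (6 * a) * ((s : ℝ) ^ (6 * a) * ρ ^ s) := by positivity
    calc (n : ℝ) ^ (6 * n) * ρ ^ (s * s)
        ≤ (a * s : ℝ) ^ (6 * (a * s)) * ρ ^ (s * s) := by
          refine mul_le_mul_of_nonneg_right ?_ (by positivity)
          exact (pow_le_pow_left₀ (by positivity) hnaR _).trans
            (pow_le_pow_right₀ (hn1R.trans hnaR) (by omega))
      _ = ((a : ℝ) ^ (6 * a) * ((s : ℝ) ^ (6 * a) * ρ ^ s)) ^ s := by
          rw [mul_pow, mul_pow, mul_pow, ← pow_mul, ← pow_mul, ← pow_mul]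
          ring
      _ ≤ (a : ℝ) ^ (6 * a) * ((s : ℝ) ^ (6 * a) * ρ ^ s) :=
          pow_le_of_le_one hx0 (b1.trans (min_le_left _ _)) (by omega)
      _ ≤ ε / 2 := b1.trans (min_le_right _ _)
  have g2 : (n : ℝ) ^ 3 * (63 / 64) ^ (n / k) ≤ ε / 2 := by
    calc (n : ℝ) ^ 3 * (63 / 64) ^ (n / k) ≤ (a * s : ℝ) ^ 3 * (63 / 64) ^ s := by
          refine mul_le_mul (pow_le_pow_left₀ (by positivity) hnaR _)
            (pow_le_pow_of_le_one (by norm_num) (by norm_num) hMs) (by positivity) (by positivity)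
      _ = (a : ℝ) ^ 3 * ((s : ℝ) ^ 3 * (63 / 64 : ℝ) ^ s) := by ring
      _ ≤ ε / 2 := b2
  linarith

end Probability

/-- Asymptotically almost surely, a random orientation `G` of the Turán graph `T(n,k)`
(`k ≥ 2` fixed) satisfies `f_k(G) = ⌊n/k⌋ − k + 1`: every minimal feedback arc set of `G`
contains `⌊n/k⌋ − k + 1` pairwise vertex-disjoint transitive `k`-cliques, and some
minimal feedback arc set contains no more than that many. -/
theorem aas_fk_of_random_turan_tournament (k : ℕ) (hk : 2 ≤ k) :
    ∀ ε : ℝ, 0 < ε → ∃ N : ℕ, ∀ n ≥ N,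
      (Nat.card {ω : Fin n → Fin n → Bool // ¬ (
          (∀ F : Fin n → Fin n → Prop, IsMinFAS (turanEdge k ω) F →
            ∃ C : Finset (Finset (Fin n)), C.card = n / k + 1 - k ∧
              (∀ S ∈ C, IsTransClique F k S) ∧
              (∀ S ∈ C, ∀ S' ∈ C, S ≠ S' → Disjoint S S')) ∧
          (∃ F : Fin n → Fin n → Prop, IsMinFAS (turanEdge k ω) F ∧
            ∀ C : Finset (Finset (Fin n)), (∀ S ∈ C, IsTransClique F k S) →
              (∀ S ∈ C, ∀ S' ∈ C, S ≠ S' → Disjoint S S') →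
              C.card ≤ n / k + 1 - k))} : ℝ)
        ≤ ε * 2 ^ (n * n) := by
  intro ε hε
  obtain ⟨N, hN⟩ := exists_scale k hk hε
  refine ⟨max N 2, fun n hn => ?_⟩
  obtain ⟨s, hs, hsn, hε'⟩ := hN n ((le_max_left _ _).trans hn)
  have hn2 : 2 ≤ n := (le_max_right _ _).trans hn
  have hkn' : k ≤ n / k := by
    refine le_trans ?_ hsn
    have h1 : 1 ≤ 2 ^ k := Nat.one_le_two_pow
    calc k = 1 * (1 * k * 1) := by ring
      _ ≤ 160 * (2 ^ k * k ^ 2 * s) := by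
        gcongr
        · norm_num
        · exact Nat.le_self_pow (by norm_num) k
        · omega
  have hkn : k ≤ n := hkn'.trans (Nat.div_le_self n k)
  classical
  rw [Nat.card_eq_fintype_card, Fintype.card_subtype]
  have h1 := card_not_joinDense_le hn2 hkn s
  have h2 := card_small_commonDegree_le (k := k) hkn
  have hsub := (Finset.card_le_card (s := Finset.univ.filter fun ω : Fin n → Fin n → Bool => ¬ (
          (∀ F : Fin n → Fin n → Prop, IsMinFAS (turanEdge k ω) F →
            ∃ C : Finset (Finset (Fin n)), C.card = n / k + 1 - k ∧
              (∀ S ∈ C, IsTransClique F k S) ∧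
              (∀ S ∈ C, ∀ S' ∈ C, S ≠ S' → Disjoint S S')) ∧
          (∃ F : Fin n → Fin n → Prop, IsMinFAS (turanEdge k ω) F ∧
            ∀ C : Finset (Finset (Fin n)), (∀ S ∈ C, IsTransClique F k S) →
              (∀ S ∈ C, ∀ S' ∈ C, S ≠ S' → Disjoint S S') →
              C.card ≤ n / k + 1 - k))) (t :=
    (Finset.univ.filter fun ω => ∃ π : Fin n → Fin (n * n),
        ¬ JoinDense (partAdj k (fun x => (π x : ℕ)) ω) s (2 ^ k)) ∪
    (Finset.univ.filter fun ω => ∃ x : Fin n × Fin n × Fin k, x.1 ≠ x.2.1 ∧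
      (x.1 : ℕ) % k ≠ x.2.2 ∧ (x.2.1 : ℕ) % k ≠ x.2.2 ∧
      8 * commonDegree k ω x.1 x.2.1 x.2.2 < n / k)) (by
    intro ω hω
    have hω := (Finset.mem_filter.1 hω).2
    by_contra hnot
    rw [Finset.mem_union, not_or, Finset.mem_filter, Finset.mem_filter] at hnot
    obtain ⟨hB, hP⟩ := hnot
    refine hω ⟨fun F hF => exists_trans_cliques hk hs hsn ?_ ?_ hF,
      exists_isMinFAS_few_cliques hk hkn' ω⟩
    · intro π
      by_contra h
      exact hB ⟨Finset.mem_univ _, π, h⟩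
    · intro v v' i h1 h2 h3
      by_contra h
      exact hP ⟨Finset.mem_univ _, (v, v', i), h1, h2, h3, not_le.1 h⟩)).trans
    (Finset.card_union_le _ _)
  refine (Nat.cast_le.2 hsub).trans ?_
  rw [Nat.cast_add]
  calc _ ≤ (n : ℝ) ^ (6 * n) * (2 ^ (n * n) * (1 - 1 / 4 ^ k) ^ (s * s)) +
        n ^ 3 * (2 ^ (n * n) * (63 / 64) ^ (n / k)) := add_le_add h1 h2
    _ = ((n : ℝ) ^ (6 * n) * (1 - 1 / 4 ^ k) ^ (s * s) + n ^ 3 * (63 / 64) ^ (n / k)) *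
        2 ^ (n * n) := by ring
    _ ≤ ε * 2 ^ (n * n) := mul_le_mul_of_nonneg_right hε' (by positivity)
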